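/- arXiv:2005.05427 — 5 statements merged into one kernel-verified Lean document; each statement's English description precedes it below -/
import Mathlib

section
/- Every execution of the interval-concurrent queue with weak-emptiness check in which no dequeue operation returns the weak-empty value εʷ is an execution of the sequential queue. -/
/-- Operations of a queue over items in ℕ. -/
inductive QueueOp
  | enq (x : ℕ)
  | deq
  deriving DecidableEq

/-- Possible outputs: `ok` (= true, for enqueue), an item, empty (ε),
or weak-empty (εʷ). -/
inductive QueueRes
  | ok
  | val (x : ℕ)
  | empty
  | weakEmpty
  deriving DecidableEq

/-- A state of the interval-concurrent queue with weak-emptiness check for `n`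
processes: the queue content `q`, and for each process either `none` (no pending
weak dequeue) or the prefix of `q` that must still be dequeued before its pending
dequeue may return εʷ. -/
structure IQState (n : ℕ) where
  q : List ℕ
  P : Fin n → Option (List ℕ)

/-- The atomic events (linearization points) of the interval-concurrent queue with
weak-emptiness check. -/
inductive IQEvent (n : ℕ)
  | enq (i : Fin n) (x : ℕ)        -- Enq(x) returning true
  | deqVal (i : Fin n) (x : ℕ)     -- Deq removing and returning the head x
  | deqEmpty (i : Fin n)           -- Deq returning ε on the empty queue
  | deqWeakPoint (i : Fin n)       -- Deq returning εʷ at a single point (empty queue)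
  | deqStart (i : Fin n)           -- a Deq becomes pending: P[i] := current q
  | deqWeakEnd (i : Fin n)         -- a pending Deq returns εʷ (requires P[i] = ε)
  deriving DecidableEq

/-- Transitions of the interval-concurrent queue with weak-emptiness check. -/
inductive IQStep {n : ℕ} : IQState n → IQEvent n → IQState n → Prop
  | enq (s : IQState n) (i : Fin n) (x : ℕ) (h : s.P i = none) :
      IQStep s (.enq i x) ⟨s.q ++ [x], s.P⟩
  | deqVal (s : IQState n) (i : Fin n) (x : ℕ) (q' : List ℕ)
      (h : s.P i = none) (hq : s.q = x :: q') :
      IQStep s (.deqVal i x) ⟨q', fun j => (s.P j).map List.tail⟩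
  | deqEmpty (s : IQState n) (i : Fin n) (h : s.P i = none) (hq : s.q = []) :
      IQStep s (.deqEmpty i) s
  | deqWeakPoint (s : IQState n) (i : Fin n) (h : s.P i = none) (hq : s.q = []) :
      IQStep s (.deqWeakPoint i) s
  | deqStart (s : IQState n) (i : Fin n) (h : s.P i = none) :
      IQStep s (.deqStart i) ⟨s.q, Function.update s.P i (some s.q)⟩
  | deqWeakEnd (s : IQState n) (i : Fin n) (h : s.P i = some []) :
      IQStep s (.deqWeakEnd i) ⟨s.q, Function.update s.P i none⟩

/-- An execution of the interval-concurrent queue: a sequence of events taking one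
state to another. -/
inductive IQExec {n : ℕ} : IQState n → List (IQEvent n) → IQState n → Prop
  | nil (s : IQState n) : IQExec s [] s
  | cons {s s' s'' : IQState n} {e : IQEvent n} {es : List (IQEvent n)} :
      IQStep s e s' → IQExec s' es s'' → IQExec s (e :: es) s''

/-- The sequential operation (with output) performed at an event; `deqStart` has no
response, each other event corresponds to one completed operation. -/
def IQEvent.toSeqOp {n : ℕ} : IQEvent n → Option (QueueOp × QueueRes)
  | .enq _ x => some (.enq x, .ok)
  | .deqVal _ x => some (.deq, .val x)
  | .deqEmpty _ => some (.deq, .empty)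
  | .deqWeakPoint _ => some (.deq, .weakEmpty)
  | .deqStart _ => none
  | .deqWeakEnd _ => some (.deq, .weakEmpty)

/-- Transition of the sequential queue. -/
def SeqQueueDelta (q : List ℕ) (p : QueueOp × QueueRes) (q' : List ℕ) : Prop :=
  (∃ x, p = (QueueOp.enq x, QueueRes.ok) ∧ q' = q ++ [x]) ∨
  (∃ x, q = x :: q' ∧ p = (QueueOp.deq, QueueRes.val x)) ∨
  (q = [] ∧ q' = [] ∧ p = (QueueOp.deq, QueueRes.empty))

/-- A sequential execution of the sequential queue. -/
inductive SeqQueueExec : List ℕ → List (QueueOp × QueueRes) → List ℕ → Prop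
  | nil (q : List ℕ) : SeqQueueExec q [] q
  | cons {q q' q'' : List ℕ} {p : QueueOp × QueueRes} {ps : List (QueueOp × QueueRes)} :
      SeqQueueDelta q p q' → SeqQueueExec q' ps q'' → SeqQueueExec q (p :: ps) q''

/-- A step that completes an operation other than a weak-empty dequeue acts on the queue
content as the sequential queue does. -/
theorem IQStep.seqQueueDelta {n : ℕ} {s s' : IQState n} {e : IQEvent n}
    {p : QueueOp × QueueRes} (h : IQStep s e s') (hp : e.toSeqOp = some p)
    (hw : p ≠ (QueueOp.deq, QueueRes.weakEmpty)) : SeqQueueDelta s.q p s'.q := by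
  cases h <;> simp only [IQEvent.toSeqOp, Option.some.injEq, reduceCtorEq] at hp <;> subst hp
  case enq i x h => exact Or.inl ⟨x, rfl, rfl⟩
  case deqVal i x q' h hq => exact Or.inr (Or.inl ⟨x, hq, rfl⟩)
  case deqEmpty i h hq => exact Or.inr (Or.inr ⟨hq, hq, rfl⟩)
  all_goals exact absurd rfl hw

/-- A step that completes no operation leaves the queue content unchanged. -/
theorem IQStep.q_eq_of_toSeqOp_eq_none {n : ℕ} {s s' : IQState n} {e : IQEvent n}
    (h : IQStep s e s') (he : e.toSeqOp = none) : s'.q = s.q := by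
  cases h <;> simp_all [IQEvent.toSeqOp]

/-- From any state, an execution without weak-empty responses projects to an execution of the
sequential queue on the queue content. -/
theorem IQExec.seqQueueExec {n : ℕ} {s s' : IQState n} {E : List (IQEvent n)}
    (h : IQExec s E s')
    (hE : ∀ e ∈ E, e.toSeqOp ≠ some (QueueOp.deq, QueueRes.weakEmpty)) :
    SeqQueueExec s.q (E.filterMap IQEvent.toSeqOp) s'.q := by
  induction h with
  | nil s => exact .nil s.q
  | @cons s t u e es hstep _ ih =>
    have htail := ih fun e' he' => hE e' (List.mem_cons_of_mem e he')
    cases he : e.toSeqOp with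
    | none =>
      rw [List.filterMap_cons_none he, ← hstep.q_eq_of_toSeqOp_eq_none he]
      exact htail
    | some p =>
      rw [List.filterMap_cons_some he]
      refine .cons (hstep.seqQueueDelta he fun hp => ?_) htail
      exact hE e List.mem_cons_self (hp ▸ he)

/-- Every execution of the interval-concurrent queue with weak-emptiness check in
which no dequeue operation returns the weak-empty value εʷ is an execution of the
sequential queue. -/
theorem intervalConcurrentQueue_noWeakEmpty_is_sequential
    (n : ℕ) (E : List (IQEvent n)) (sf : IQState n)
    (hexec : IQExec ⟨[], fun _ => none⟩ E sf)
    (hnoweak : ∀ e ∈ E, e.toSeqOp ≠ some (QueueOp.deq, QueueRes.weakEmpty)) :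
    SeqQueueExec [] (E.filterMap IQEvent.toSeqOp) sf.q := by
  exact hexec.seqQueueExec hnoweak
end

section
/- Let A be any set-linearizable implementation of the set-concurrent stack with multiplicity. Then every sequential execution of A (one in which no two operations are concurrent) is an execution of the sequential stack. -/
/-- Operations of a stack over items in ℕ. -/
inductive StackOp
  | push (x : ℕ)
  | pop
  deriving DecidableEq

/-- Possible outputs: `ok` (= true, for push), an item, or empty (ε). -/
inductive StackRes
  | ok
  | val (x : ℕ)
  | empty
  deriving DecidableEq

/-- A concurrent history (execution at the interface level): `m` operations, each
with its kind, its invocation time, and, if it is completed, its response time and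
its output (`none` in both fields means the operation is pending). -/
structure ConcHistory (Op Res : Type) where
  m : ℕ
  op : Fin m → Op
  inv : Fin m → ℕ
  ret : Fin m → Option ℕ
  out : Fin m → Option Res

/-- `op i` precedes `op j`: the response of `i` occurs before the invocation of `j`. -/
def ConcHistory.precedes {Op Res : Type} (h : ConcHistory Op Res) (i j : Fin h.m) : Prop :=
  ∃ t, h.ret i = some t ∧ t < h.inv j

/-- Two operations are concurrent if they are incomparable w.r.t. `precedes`. -/
def ConcHistory.concurrent {Op Res : Type} (h : ConcHistory Op Res) (i j : Fin h.m) : Prop :=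
  ¬ h.precedes i j ∧ ¬ h.precedes j i

/-- Transition of the set-concurrent stack with multiplicity taken by a concurrency
class `C` of operations (given by their indices in a history): either a single push,
or between 1 and `n` concurrent pops all returning the top item, or a single pop
returning empty on the empty stack. -/
def stackClassDelta (n : ℕ) {m : ℕ} (op : Fin m → StackOp) (out : Fin m → StackRes)
    (q : List ℕ) (C : Finset (Fin m)) (q' : List ℕ) : Prop :=
  (∃ i x, C = {i} ∧ op i = StackOp.push x ∧ out i = StackRes.ok ∧ q' = x :: q) ∨
  (∃ x, q = x :: q' ∧ 1 ≤ C.card ∧ C.card ≤ n ∧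
      ∀ i ∈ C, op i = StackOp.pop ∧ out i = StackRes.val x) ∨
  (∃ i, C = {i} ∧ op i = StackOp.pop ∧ out i = StackRes.empty ∧ q = [] ∧ q' = [])

/-- A set-linearization of a history `h` w.r.t. the set-concurrent stack with
multiplicity (`n` processes): operations are assigned to `K` linearly ordered
concurrency classes (every completed operation is assigned, pending ones may be),
outputs agree with those of `h` on completed operations, consecutive classes are
related by the transition relation starting from the empty stack, and the
real-time order of `h` is respected. -/
structure SetLinearization (n : ℕ) (h : ConcHistory StackOp StackRes) where
  K : ℕ
  cls : Fin h.m → Option (Fin K)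
  lout : Fin h.m → StackRes
  states : Fin (K + 1) → List ℕ
  complete_assigned : ∀ i, (h.out i).isSome → (cls i).isSome
  out_agree : ∀ i r, h.out i = some r → lout i = r
  init : states 0 = []
  classes_nonempty : ∀ k : Fin K, ∃ i, cls i = some k
  step : ∀ k : Fin K,
    stackClassDelta n h.op lout (states k.castSucc)
      (Finset.univ.filter (fun i => cls i = some k)) (states k.succ)
  order : ∀ i j ki kj, h.precedes i j → cls i = some ki → cls j = some kj →
    (ki : ℕ) < (kj : ℕ)

/-- A history is set-linearizable w.r.t. the set-concurrent stack with multiplicity. -/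
def SetLinearizable (n : ℕ) (h : ConcHistory StackOp StackRes) : Prop :=
  Nonempty (SetLinearization n h)

/-- Transition of the sequential stack. -/
def SeqStackDelta (q : List ℕ) (p : StackOp × StackRes) (q' : List ℕ) : Prop :=
  (∃ x, p = (StackOp.push x, StackRes.ok) ∧ q' = x :: q) ∨
  (∃ x, q = x :: q' ∧ p = (StackOp.pop, StackRes.val x)) ∨
  (q = [] ∧ q' = [] ∧ p = (StackOp.pop, StackRes.empty))

/-- A sequential execution of the sequential stack. -/
inductive SeqStackExec : List ℕ → List (StackOp × StackRes) → List ℕ → Prop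
  | nil (q : List ℕ) : SeqStackExec q [] q
  | cons {q q' q'' : List ℕ} {p : StackOp × StackRes} {ps : List (StackOp × StackRes)} :
      SeqStackDelta q p q' → SeqStackExec q' ps q'' → SeqStackExec q (p :: ps) q''

/-- A linearization of a history `h` w.r.t. the sequential stack: a sequence of
(distinct) operations of `h` containing all completed ones, whose outputs agree
with `h`, respecting the real-time order of `h`, and forming a sequential execution
of the stack from the empty initial state. -/
structure Linearization (h : ConcHistory StackOp StackRes) where
  seq : List (Fin h.m)
  lout : Fin h.m → StackRes
  nodup : seq.Nodup
  complete_mem : ∀ i, (h.out i).isSome → i ∈ seq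
  out_agree : ∀ i r, h.out i = some r → lout i = r
  order : ∀ k1 k2 : Fin seq.length,
    h.precedes (seq.get k1) (seq.get k2) → (k1 : ℕ) < (k2 : ℕ)
  valid : ∃ qf, SeqStackExec [] (seq.map (fun i => (h.op i, lout i))) qf

/-- A history is linearizable w.r.t. the sequential stack. -/
def Linearizable (h : ConcHistory StackOp StackRes) : Prop :=
  Nonempty (Linearization h)

/-- A chain of sequential stack transitions is a sequential execution of the stack. -/
theorem SeqStackExec.ofFn {K : ℕ} (states : Fin (K + 1) → List ℕ)
    (p : Fin K → StackOp × StackRes)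
    (step : ∀ k : Fin K, SeqStackDelta (states k.castSucc) (p k) (states k.succ)) :
    SeqStackExec (states 0) (List.ofFn p) (states (Fin.last K)) := by
  induction K with
  | zero => simpa using SeqStackExec.nil (states 0)
  | succ K ih =>
    rw [List.ofFn_succ]
    exact .cons (step 0) (ih (fun k => states k.succ) (fun k => p k.succ) fun k => step k.succ)

/-- On a singleton concurrency class, the set-concurrent stack with multiplicity behaves as the
sequential stack. -/
theorem SeqStackDelta.of_stackClassDelta_singleton {n m : ℕ} {op : Fin m → StackOp}
    {out : Fin m → StackRes} {q q' : List ℕ} {i : Fin m}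
    (hδ : stackClassDelta n op out q {i} q') : SeqStackDelta q (op i, out i) q' := by
  rcases hδ with ⟨j, x, hj, hop, hout, hq⟩ | ⟨x, hq, -, -, hC⟩ | ⟨j, hj, hop, hout, hq, hq'⟩
  · obtain rfl := Finset.singleton_injective hj
    exact .inl ⟨x, by rw [hop, hout], hq⟩
  · obtain ⟨hop, hout⟩ := hC i (Finset.mem_singleton_self i)
    exact .inr (.inl ⟨x, hq, by rw [hop, hout]⟩)
  · obtain rfl := Finset.singleton_injective hj
    exact .inr (.inr ⟨hq, hq', by rw [hop, hout]⟩)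

/-- Distinct operations in a common concurrency class of a set-linearization are concurrent. -/
theorem SetLinearization.concurrent_of_cls_eq {n : ℕ} {h : ConcHistory StackOp StackRes}
    (L : SetLinearization n h) {i j : Fin h.m} {k : Fin L.K}
    (hi : L.cls i = some k) (hj : L.cls j = some k) : h.concurrent i j :=
  ⟨fun hp => (L.order i j k k hp hi hj).false, fun hp => (L.order j i k k hp hj hi).false⟩

/-- Let `A` be any set-linearizable implementation (identified with its set of
histories) of the set-concurrent stack with multiplicity.  Then every sequential
execution of `A` (one in which no two distinct operations are concurrent) is an
execution of the sequential stack. -/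
theorem setLinearizableStack_sequential_execution_is_sequentialStack
    (n : ℕ) (A : Set (ConcHistory StackOp StackRes))
    (hA : ∀ h ∈ A, SetLinearizable n h)
    (h : ConcHistory StackOp StackRes) (hmem : h ∈ A)
    (hseq : ∀ i j : Fin h.m, i ≠ j → ¬ h.concurrent i j) :
    Linearizable h := by
  obtain ⟨L⟩ := hA h hmem
  choose f hf using L.classes_nonempty
  have huniq : ∀ i k, L.cls i = some k → i = f k := fun i k hi => by
    by_contra hne
    exact hseq i (f k) hne (L.concurrent_of_cls_eq hi (hf k))
  have hclass : ∀ k, Finset.univ.filter (fun i => L.cls i = some k) = {f k} := fun k => by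
    ext i
    simp only [Finset.mem_filter, Finset.mem_univ, true_and, Finset.mem_singleton]
    exact ⟨huniq i k, fun hi => hi ▸ hf k⟩
  have hinj : Function.Injective f := fun a b hab =>
    Option.some_injective _ (by rw [← hf a, ← hf b, hab])
  refine ⟨⟨List.ofFn f, L.lout, List.nodup_ofFn.2 hinj, fun i hi => ?_, L.out_agree,
    fun k₁ k₂ hp => ?_, L.states (Fin.last L.K), ?_⟩⟩
  · obtain ⟨k, hk⟩ := Option.isSome_iff_exists.1 (L.complete_assigned i hi)
    exact List.mem_ofFn.2 ⟨k, (huniq i k hk).symm⟩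
  · rw [List.get_ofFn, List.get_ofFn] at hp
    exact L.order _ _ _ _ hp (hf _) (hf _)
  · rw [List.map_ofFn, ← L.init]
    refine SeqStackExec.ofFn L.states _ fun k => ?_
    have hstep := L.step k
    rw [hclass] at hstep
    exact .of_stackClassDelta_singleton hstep
end

section
/- Let A be any set-linearizable implementation of the set-concurrent stack with multiplicity. If in an execution of A two Pop operations return the same (non-empty) value, then those two operations are concurrent. -/
namespace SetLinearization

variable {n : ℕ} {h : ConcHistory StackOp StackRes}

/-- A class either pushes a fresh top item, pops the top item, or keeps the state unchanged. -/
theorem step_cases (L : SetLinearization n h) (k : Fin L.K) :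
    (∃ i y, h.op i = StackOp.push y ∧ L.cls i = some k ∧
      L.states k.succ = y :: L.states k.castSucc) ∨
    (∃ y, L.states k.castSucc = y :: L.states k.succ) ∨
    L.states k.succ = L.states k.castSucc := by
  rcases L.step k with ⟨i, y, hC, hop, -, hq⟩ | ⟨y, hq, -⟩ | ⟨i, -, -, -, hq, hq'⟩
  · have hi : i ∈ Finset.univ.filter (fun i => L.cls i = some k) := by
      rw [hC]
      exact Finset.mem_singleton_self i
    exact Or.inl ⟨i, y, hop, by simpa using hi, hq⟩
  · exact Or.inr (Or.inl ⟨y, hq⟩)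
  · exact Or.inr (Or.inr (hq'.trans hq.symm))

/-- If every item is pushed at most once, the reachable states have no repeated items, and
every item of a state was pushed by an earlier class. -/
theorem states_nodup_and_pushed (L : SetLinearization n h)
    (hpush : ∀ (i j : Fin h.m) (x : ℕ),
      h.op i = StackOp.push x → h.op j = StackOp.push x → i = j)
    (k : Fin (L.K + 1)) :
    (L.states k).Nodup ∧ ∀ y ∈ L.states k, ∃ i l, h.op i = StackOp.push y ∧
      L.cls i = some l ∧ (l : ℕ) < k := by
  induction k using Fin.induction with
  | zero => simp [L.init]
  | succ k ih =>
    obtain ⟨hnd, hmem⟩ := ih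
    have hpushed : ∀ y ∈ L.states k.castSucc, ∃ i l, h.op i = StackOp.push y ∧
        L.cls i = some l ∧ (l : ℕ) < k.succ := by
      intro y hy
      obtain ⟨i, l, hi, hl, hlt⟩ := hmem y hy
      exact ⟨i, l, hi, hl, hlt.trans (by simp)⟩
    rcases L.step_cases k with ⟨i, y, hop, hcls, hq⟩ | ⟨y, hq⟩ | hq
    · rw [hq]
      refine ⟨List.nodup_cons.2 ⟨fun hy => ?_, hnd⟩, fun z hz => ?_⟩
      · obtain ⟨j, l, hj, hl, hlt⟩ := hmem y hy
        obtain rfl := hpush i j y hop hj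
        rw [hcls, Option.some.injEq] at hl
        subst hl
        simp at hlt
      · rcases List.mem_cons.1 hz with rfl | hz
        · exact ⟨i, k, hop, hcls, by simp⟩
        · exact hpushed z hz
    · rw [hq] at hnd hpushed
      exact ⟨(List.nodup_cons.1 hnd).2, fun z hz => hpushed z (List.mem_cons_of_mem _ hz)⟩
    · rw [hq]
      exact ⟨hnd, hpushed⟩

/-- Once popped, an item that is pushed at most once never reappears. -/
theorem notMem_states_of_popped (L : SetLinearization n h)
    (hpush : ∀ (i j : Fin h.m) (x : ℕ),
      h.op i = StackOp.push x → h.op j = StackOp.push x → i = j)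
    {x : ℕ} {a : Fin L.K} (ha : L.states a.castSucc = x :: L.states a.succ)
    (k : Fin (L.K + 1)) (hk : (a : ℕ) < k) : x ∉ L.states k := by
  obtain ⟨hnd, hmem⟩ := L.states_nodup_and_pushed hpush a.castSucc
  rw [ha] at hnd hmem
  obtain ⟨p, l, hp, hl, hla⟩ := hmem x List.mem_cons_self
  induction k using Fin.induction with
  | zero => simp at hk
  | succ k ih =>
    rcases eq_or_ne a k with rfl | hne
    · exact (List.nodup_cons.1 hnd).1
    · have hak : (a : ℕ) < k := by
        have := Fin.val_ne_of_ne hne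
        simp only [Fin.val_succ] at hk
        omega
      have hx := ih hak
      rcases L.step_cases k with ⟨i, y, hop, hcls, hq⟩ | ⟨y, hq⟩ | hq
      · rw [hq, List.mem_cons]
        rintro (rfl | hmem_x)
        · obtain rfl := hpush i p x hop hp
          rw [hcls, Option.some.injEq] at hl
          subst hl
          simp only [Fin.val_castSucc] at hla
          omega
        · exact hx hmem_x
      · rw [hq] at hx
        exact fun hmem_x => hx (List.mem_cons_of_mem _ hmem_x)
      · rwa [hq]

/-- The class of an operation returning the item `x` pops `x` from the top of the stack. -/
theorem exists_popping_class (L : SetLinearization n h) {i : Fin h.m} {x : ℕ}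
    (hi : h.out i = some (StackRes.val x)) :
    ∃ k, L.cls i = some k ∧ L.states k.castSucc = x :: L.states k.succ := by
  obtain ⟨k, hk⟩ := Option.isSome_iff_exists.1 (L.complete_assigned i (by simp [hi]))
  have hout := L.out_agree i _ hi
  have hmem : i ∈ Finset.univ.filter (fun i => L.cls i = some k) := by simp [hk]
  refine ⟨k, hk, ?_⟩
  rcases L.step k with ⟨j, y, hC, -, hj, -⟩ | ⟨y, hq, -, -, hall⟩ | ⟨j, hC, -, hj, -⟩
  · rw [hC, Finset.mem_singleton] at hmem
    subst hmem
    simp [hout] at hj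
  · have hy := (hall i hmem).2
    rw [hout, StackRes.val.injEq] at hy
    rwa [hy]
  · rw [hC, Finset.mem_singleton] at hmem
    subst hmem
    simp [hout] at hj

end SetLinearization

/-- Let `A` be any set-linearizable implementation (identified with its set of
histories) of the set-concurrent stack with multiplicity, where every item is
pushed at most once.  If in an execution of `A` two distinct Pop operations return
the same (non-empty) value, then those two operations are concurrent. -/
theorem setLinearizableStack_samePopValue_concurrent
    (n : ℕ) (A : Set (ConcHistory StackOp StackRes))
    (hA : ∀ h ∈ A, SetLinearizable n h)
    (h : ConcHistory StackOp StackRes) (hmem : h ∈ A)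
    (hpushUnique : ∀ (i j : Fin h.m) (x : ℕ),
      h.op i = StackOp.push x → h.op j = StackOp.push x → i = j)
    (i j : Fin h.m) (x : ℕ) (hij : i ≠ j)
    (hi : h.out i = some (StackRes.val x)) (hj : h.out j = some (StackRes.val x)) :
    h.concurrent i j := by
  obtain ⟨L⟩ := hA h hmem
  obtain ⟨a, hia, ha⟩ := L.exists_popping_class hi
  obtain ⟨b, hjb, hb⟩ := L.exists_popping_class hj
  have hab : ¬ (a : ℕ) < b := fun hlt =>
    L.notMem_states_of_popped hpushUnique ha b.castSucc hlt (by simp [hb])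
  have hba : ¬ (b : ℕ) < a := fun hlt =>
    L.notMem_states_of_popped hpushUnique hb a.castSucc hlt (by simp [ha])
  exact ⟨fun hp => hab (L.order i j a b hp hia hjb), fun hp => hba (L.order j i b a hp hjb hia)⟩
end

section
/- The algorithm SetSeqStack is a wait-free set-linearizable implementation of the set-concurrent stack with multiplicity, using only read/write base objects (registers and a read/write wait-free linearizable counter). -/
/-- Local control states of a process executing the algorithm SetSeqStack.
Rows of `Items` are indexed from 1 and columns from 1 to `n` (the column of
process `pᵢ` is `i + 1` for `i : Fin n`). -/
inductive PS
  | idle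
  | push1 (x : ℕ)              -- Push(x): about to read the counter `Top`
  | push2 (x : ℕ) (top : ℕ)    -- read `top` from `Top`: about to increment `Top`
  | push3 (x : ℕ) (top : ℕ)    -- about to write x into `Items[top][i]`
  | pop1                        -- Pop(): about to read the counter `Top`
  | popScan (r s : ℕ)          -- about to read `Items[r][s]`
  | popFound (r s x : ℕ)       -- read item x in `Items[r][s]`: about to write ⊥
  | done (res : StackRes)       -- computed result, about to respond
  deriving DecidableEq

/-- A record of a completed operation: process, operation, output,
invocation time and response time. -/
structure LogEntry (n : ℕ) where
  proc : Fin n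
  op : StackOp
  res : StackRes
  invT : ℕ
  retT : ℕ

/-- A configuration of the system running SetSeqStack: the counter `Top`, the
array `Items` (`none` = ⊥), the local states, the pending operation (with its
invocation time) of each process, the log of completed operations and the
global time (number of steps so far). -/
structure Config (n : ℕ) where
  top : ℕ
  items : ℕ → ℕ → Option ℕ
  proc : Fin n → PS
  pend : Fin n → Option (StackOp × ℕ)
  log : List (LogEntry n)
  time : ℕ

/-- The initial configuration: `Top = 1`, all entries of `Items` equal ⊥,
all processes idle. -/
def initConfig (n : ℕ) : Config n :=
  { top := 1
    items := fun _ _ => none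
    proc := fun _ => PS.idle
    pend := fun _ => none
    log := []
    time := 0 }

/-- One atomic step of process `i` in the algorithm SetSeqStack: an invocation of
a new operation, one shared-memory access of the algorithm's code, or a response. -/
inductive Step {n : ℕ} : Config n → Fin n → Config n → Prop
  | invPush (c : Config n) (i : Fin n) (x : ℕ)
      (h : c.proc i = PS.idle) (hp : c.pend i = none) :
      Step c i { c with proc := Function.update c.proc i (PS.push1 x),
                        pend := Function.update c.pend i (some (StackOp.push x, c.time)),
                        time := c.time + 1 }
  | invPop (c : Config n) (i : Fin n)
      (h : c.proc i = PS.idle) (hp : c.pend i = none) :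
      Step c i { c with proc := Function.update c.proc i PS.pop1,
                        pend := Function.update c.pend i (some (StackOp.pop, c.time)),
                        time := c.time + 1 }
  | pushReadTop (c : Config n) (i : Fin n) (x : ℕ)
      (h : c.proc i = PS.push1 x) :
      Step c i { c with proc := Function.update c.proc i (PS.push2 x c.top),
                        time := c.time + 1 }
  | pushIncTop (c : Config n) (i : Fin n) (x t : ℕ)
      (h : c.proc i = PS.push2 x t) :
      Step c i { c with top := c.top + 1,
                        proc := Function.update c.proc i (PS.push3 x t),
                        time := c.time + 1 }
  | pushWrite (c : Config n) (i : Fin n) (x t : ℕ)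
      (h : c.proc i = PS.push3 x t) :
      Step c i { c with items := fun r s =>
                          if r = t ∧ s = (i : ℕ) + 1 then some x else c.items r s,
                        proc := Function.update c.proc i (PS.done StackRes.ok),
                        time := c.time + 1 }
  | popReadTop_pos (c : Config n) (i : Fin n)
      (h : c.proc i = PS.pop1) (ht : 2 ≤ c.top) :
      Step c i { c with proc := Function.update c.proc i (PS.popScan (c.top - 1) n),
                        time := c.time + 1 }
  | popReadTop_empty (c : Config n) (i : Fin n)
      (h : c.proc i = PS.pop1) (ht : c.top ≤ 1) :
      Step c i { c with proc := Function.update c.proc i (PS.done StackRes.empty),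
                        time := c.time + 1 }
  | popRead_found (c : Config n) (i : Fin n) (r s x : ℕ)
      (h : c.proc i = PS.popScan r s) (hx : c.items r s = some x) :
      Step c i { c with proc := Function.update c.proc i (PS.popFound r s x),
                        time := c.time + 1 }
  | popRead_miss_col (c : Config n) (i : Fin n) (r s : ℕ)
      (h : c.proc i = PS.popScan r s) (hx : c.items r s = none) (hs : 2 ≤ s) :
      Step c i { c with proc := Function.update c.proc i (PS.popScan r (s - 1)),
                        time := c.time + 1 }
  | popRead_miss_row (c : Config n) (i : Fin n) (r : ℕ)
      (h : c.proc i = PS.popScan r 1) (hx : c.items r 1 = none) (hr : 2 ≤ r) :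
      Step c i { c with proc := Function.update c.proc i (PS.popScan (r - 1) n),
                        time := c.time + 1 }
  | popRead_miss_end (c : Config n) (i : Fin n)
      (h : c.proc i = PS.popScan 1 1) (hx : c.items 1 1 = none) :
      Step c i { c with proc := Function.update c.proc i (PS.done StackRes.empty),
                        time := c.time + 1 }
  | popWrite (c : Config n) (i : Fin n) (r s x : ℕ)
      (h : c.proc i = PS.popFound r s x) :
      Step c i { c with items := fun r' s' =>
                          if r' = r ∧ s' = s then none else c.items r' s',
                        proc := Function.update c.proc i (PS.done (StackRes.val x)),
                        time := c.time + 1 }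
  | respond (c : Config n) (i : Fin n) (res : StackRes) (op : StackOp) (t0 : ℕ)
      (h : c.proc i = PS.done res) (hp : c.pend i = some (op, t0)) :
      Step c i { c with proc := Function.update c.proc i PS.idle,
                        pend := Function.update c.pend i none,
                        log := c.log ++ [⟨i, op, res, t0, c.time⟩],
                        time := c.time + 1 }

/-- An (infinite) execution of SetSeqStack: starts in the initial configuration,
and at each moment `k` the scheduled process `sched k` performs one step. -/
def Run {n : ℕ} (c : ℕ → Config n) (sched : ℕ → Fin n) : Prop :=
  c 0 = initConfig n ∧ ∀ k, Step (c k) (sched k) (c (k + 1))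

/-- The pending operations of a configuration (with their invocation times). -/
def pendingList {n : ℕ} (cfg : Config n) : List (StackOp × ℕ) :=
  (List.finRange n).filterMap cfg.pend

/-- The history of a configuration: its completed operations (from the log)
followed by its pending operations. -/
def historyAt {n : ℕ} (cfg : Config n) : ConcHistory StackOp StackRes where
  m := cfg.log.length + (pendingList cfg).length
  op := fun k =>
    if hk : (k : ℕ) < cfg.log.length then (cfg.log.get ⟨k, hk⟩).op
    else ((pendingList cfg).getD ((k : ℕ) - cfg.log.length) (StackOp.pop, 0)).1
  inv := fun k =>
    if hk : (k : ℕ) < cfg.log.length then (cfg.log.get ⟨k, hk⟩).invT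
    else ((pendingList cfg).getD ((k : ℕ) - cfg.log.length) (StackOp.pop, 0)).2
  ret := fun k =>
    if hk : (k : ℕ) < cfg.log.length then some (cfg.log.get ⟨k, hk⟩).retT else none
  out := fun k =>
    if hk : (k : ℕ) < cfg.log.length then some (cfg.log.get ⟨k, hk⟩).res else none

/-- Abstract operations of a stack with multiplicity: the push of the item stored at a
position, the set of all pops of that item, and the pops returning empty. -/
inductive AbsOp (P E : Type)
  | push (p : P)
  | pop (p : P)
  | eps (e : E)

namespace AbsOp

variable {P E : Type}

/-- The stack of positions after an abstract operation. -/
def next (q : List P) : AbsOp P E → List P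
  | push p => p :: q
  | pop _ => q.tail
  | eps _ => q

/-- The abstract operation is enabled on the stack `q`. -/
def Enabled (q : List P) : AbsOp P E → Prop
  | push _ => True
  | pop p => q.head? = some p
  | eps _ => q = []

/-- A sequence of abstract operations is legal from the stack `q`. -/
def Valid : List P → List (AbsOp P E) → Prop
  | _, [] => True
  | q, o :: l => o.Enabled q ∧ Valid (o.next q) l

/-- The operations on the positions in `s`, together with the empty pops in `es`. -/
def Mem (s : Finset P) (popped : P → Prop) (es : List E) : AbsOp P E → Prop
  | push p => p ∈ s
  | pop p => p ∈ s ∧ popped p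
  | eps e => e ∈ es

theorem Valid.insert_pair (y : P) {l₁ l₂ : List (AbsOp P E)} {q : List P}
    (h : Valid q (l₁ ++ l₂)) : Valid q (l₁ ++ push y :: pop y :: l₂) := by
  induction l₁ generalizing q with
  | nil => simpa [Valid, Enabled, next] using h
  | cons o l ih => exact ⟨h.1, ih h.2⟩

theorem Valid.append_push (y : P) {l : List (AbsOp P E)} {q : List P}
    (h : Valid q l) : Valid q (l ++ [push y]) := by
  induction l generalizing q with
  | nil => simp [Valid, Enabled]
  | cons o l ih => exact ⟨h.1, ih h.2⟩

theorem valid_map_eps (es : List E) : Valid ([] : List P) (es.map eps) := by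
  induction es with
  | nil => trivial
  | cons e es ih => exact ⟨rfl, ih⟩

theorem Valid.enabled_foldl {l : List (AbsOp P E)} {q : List P} (h : Valid q l)
    (k : ℕ) (hk : k < l.length) : l[k].Enabled ((l.take k).foldl next q) := by
  induction l generalizing q k with
  | nil => simp at hk
  | cons o l ih =>
    cases k with
    | zero => simpa using h.1
    | succ k => simpa using ih h.2 k (by simpa using hk)

end AbsOp

/-- A list can be split so that the first part contains all elements satisfying `A`
and is empty or ends with such an element. -/
theorem List.exists_split_last {α : Type*} (A : α → Prop) (l : List α) :
    ∃ l₁ l₂, l = l₁ ++ l₂ ∧ (∀ a ∈ l₂, ¬ A a) ∧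
      (l₁ = [] ∨ ∃ l₀ a, l₁ = l₀ ++ [a] ∧ A a) := by
  induction l with
  | nil => exact ⟨[], [], by simp⟩
  | cons b l ih =>
    obtain ⟨l₁, l₂, rfl, h₂, h₁⟩ := ih
    rcases h₁ with rfl | ⟨l₀, a, rfl, ha⟩
    · by_cases hb : A b
      · exact ⟨[b], l₂, rfl, h₂, Or.inr ⟨[], b, rfl, hb⟩⟩
      · exact ⟨[], b :: l₂, rfl, by simpa [hb] using h₂, Or.inl rfl⟩
    · exact ⟨b :: (l₀ ++ [a]), l₂, rfl, h₂, Or.inr ⟨b :: l₀, a, rfl, ha⟩⟩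

/-- Scan condition of a pop active from `lo` to `hi`: each position `y` in `S` is read at
time `ρ y`, larger positions first, either before it is written or after it is removed. -/
structure ScanOK {P : Type} [LinearOrder P] (popped : P → Prop) (wt rm : P → ℕ)
    (lo hi : ℕ) (ρ : P → ℕ) (S : Set P) : Prop where
  lo_le : ∀ y ∈ S, lo ≤ ρ y
  le_hi : ∀ y ∈ S, ρ y ≤ hi
  absent : ∀ y ∈ S, ρ y ≤ wt y ∨ popped y ∧ rm y ≤ ρ y
  anti : ∀ y ∈ S, ∀ z ∈ S, y ≤ z → ρ z ≤ ρ y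

theorem ScanOK.restrict {P : Type} [LinearOrder P] {popped : P → Prop} {wt rm : P → ℕ}
    {lo hi : ℕ} {ρ : P → ℕ} {S T : Set P} (h : ScanOK popped wt rm lo hi ρ S) {y : P}
    (hy : y ∈ S) (hT : T ⊆ S) (hmax : ∀ z ∈ T, z ≤ y) :
    ScanOK popped wt rm (if rm y ≤ ρ y then max lo (rm y) else lo) hi ρ T where
  lo_le z hz := by
    have h1 := h.lo_le z (hT hz)
    have h2 := h.anti z (hT hz) y hy (hmax z hz)
    split_ifs <;> omega
  le_hi z hz := h.le_hi z (hT hz)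
  absent z hz := h.absent z (hT hz)
  anti z hz z' hz' := h.anti z (hT hz) z' (hT hz')

open AbsOp in
/-- The main combinatorial argument: operations satisfying the scan conditions can be
arranged in a legal sequence respecting the real-time order. Positions are treated in
increasing order; the pair `push y`, `pop y` for the largest position is inserted as
adjacent operations in the sequence obtained for the smaller positions. -/
theorem exists_valid_sequence {P E : Type} [LinearOrder P] (es : List E) (hes : es.Nodup)
    (ret : AbsOp P E → ℕ) (popped : P → Prop) (wt rm : P → ℕ) (ρ : AbsOp P E → P → ℕ)
    (s : Finset P) (inv : AbsOp P E → ℕ)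
    (hpush : ∀ y ∈ s, inv (push y) ≤ wt y ∧ wt y ≤ ret (push y))
    (hpop : ∀ y ∈ s, popped y → wt y ≤ rm y ∧ inv (pop y) ≤ rm y ∧ rm y ≤ ret (pop y))
    (heps : ∀ e ∈ es, inv (eps e) ≤ ret (eps e))
    (hlt : ∀ y ∈ s, ∀ z ∈ s, ret (push y) < inv (push z) → y < z)
    (hscan : ∀ x ∈ s, popped x →
      ScanOK popped wt rm (inv (pop x)) (rm x) (ρ (pop x)) {y | y ∈ s ∧ x < y})
    (hscan' : ∀ e ∈ es,
      ScanOK popped wt rm (inv (eps e)) (ret (eps e)) (ρ (eps e)) {y | y ∈ s}) :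
    ∃ L : List (AbsOp P E), L.Nodup ∧ (∀ o, o ∈ L ↔ Mem s popped es o) ∧
      L.Pairwise (fun a b => ¬ ret b < inv a) ∧ Valid [] L := by
  classical
  induction s using Finset.induction_on_max generalizing inv with
  | empty =>
    let r : E → E → Prop := fun a b => inv (eps a) ≤ inv (eps b)
    have : Std.Total r := ⟨fun a b => le_total _ _⟩
    have : IsTrans E r := ⟨fun a b c => le_trans⟩
    refine ⟨(es.insertionSort r).map eps, ?_, ?_, ?_, valid_map_eps _⟩
    · refine List.Nodup.map (fun a b h => by simpa using h) ?_
      exact (List.perm_insertionSort r es).nodup_iff.2 hes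
    · intro o
      cases o <;> simp [Mem]
    · rw [List.pairwise_map]
      refine List.Pairwise.imp_of_mem ?_ (List.pairwise_insertionSort r es)
      intro a b _ hb hab
      have := heps b (by simpa using hb)
      exact not_lt.2 (le_trans hab this)
  | insert y s hmax ih =>
    have hys : y ∉ s := fun h => lt_irrefl _ (hmax y h)
    let inv' : AbsOp P E → ℕ := fun o =>
      match o with
      | push p => inv (push p)
      | pop p => if rm y ≤ ρ (pop p) y then max (inv (pop p)) (rm y) else inv (pop p)
      | eps e => if rm y ≤ ρ (eps e) y then max (inv (eps e)) (rm y) else inv (eps e)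
    have hle : ∀ o, inv o ≤ inv' o := by
      rintro (p | p | e)
      · exact le_rfl
      all_goals
        simp only [inv']
        split_ifs <;> omega
    have hpop' : ∀ x ∈ s, popped x → inv' (pop x) ≤ rm x := by
      intro x hx hpx
      have h1 := hpop x (by simp [hx]) hpx
      have h2 := (hscan x (by simp [hx]) hpx).le_hi y ⟨by simp, hmax x hx⟩
      simp only [inv']
      split_ifs <;> omega
    have heps' : ∀ e ∈ es, inv' (eps e) ≤ ret (eps e) := by
      intro e he
      have h1 := heps e he
      have h2 := (hscan' e he).le_hi y (by simp)
      simp only [inv']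
      split_ifs <;> omega
    obtain ⟨L, hnd, hmem, hord, hval⟩ := ih inv'
      (fun x hx => hpush x (by simp [hx]))
      (fun x hx hpx => by
        have h1 := hpop x (by simp [hx]) hpx
        exact ⟨h1.1, hpop' x hx hpx, h1.2.2⟩)
      heps'
      (fun x hx z hz h => hlt x (by simp [hx]) z (by simp [hz]) h)
      (fun x hx hpx => (hscan x (by simp [hx]) hpx).restrict (y := y)
        ⟨by simp, hmax x hx⟩ (fun z hz => ⟨by simp [hz.1], hz.2⟩) (fun z hz => (hmax z hz.1).le))
      (fun e he => (hscan' e he).restrict (y := y)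
        (by simp) (fun z hz => by simp_all) (fun z hz => (hmax z hz).le))
    have hLs : ∀ o ∈ L, inv' o ≤ ret o := by
      intro o ho
      have ho := (hmem o).1 ho
      rcases o with p | p | e
      · have := hpush p (by simp [show p ∈ s from ho]); simp only [inv']; omega
      · have h1 := hpop' p ho.1 ho.2
        have := hpop p (by simp [ho.1]) ho.2
        omega
      · exact heps' e ho
    have hord' : L.Pairwise (fun a b => ¬ ret b < inv a) :=
      hord.imp (fun {a b} h h' => h (h'.trans_le (hle a)))
    have hy := hpush y (by simp)
    have hlate : ∀ o ∈ L, ret (push y) < inv o → popped y ∧ rm y ≤ inv' o := by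
      intro o ho hlt'
      have ho := (hmem o).1 ho
      rcases o with p | p | e
      · exact absurd (hlt y (by simp) p (by simp [show p ∈ s from ho]) hlt')
          (hmax p ho).le.not_gt
      · have hs := hscan p (by simp [ho.1]) ho.2
        have hm : y ∈ {z | z ∈ insert y s ∧ p < z} := ⟨by simp, hmax p ho.1⟩
        have h1 := hs.lo_le y hm
        have h2 := hs.absent y hm
        have h3 : popped y ∧ rm y ≤ ρ (pop p) y := by
          rcases h2 with h2 | h2
          · omega
          · exact h2
        refine ⟨h3.1, ?_⟩
        simp only [inv', if_pos h3.2]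
        exact le_max_right _ _
      · have hs := hscan' e ho
        have hm : y ∈ {z | z ∈ insert y s} := by simp
        have h1 := hs.lo_le y hm
        have h2 := hs.absent y hm
        have h3 : popped y ∧ rm y ≤ ρ (eps e) y := by
          rcases h2 with h2 | h2
          · omega
          · exact h2
        refine ⟨h3.1, ?_⟩
        simp only [inv', if_pos h3.2]
        exact le_max_right _ _
    have hpn : push y ∉ L := fun h => hys ((hmem _).1 h)
    have hqn : pop y ∉ L := fun h => hys ((hmem _).1 h).1
    by_cases hpy : popped y
    · have hyp := hpop y (by simp) hpy
      obtain ⟨L₁, L₂, rfl, h₂, h₁⟩ := List.exists_split_last (fun o => ret o < rm y) L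
      have hB : ∀ o ∈ L₁, inv' o < rm y := by
        intro o ho
        rcases h₁ with rfl | ⟨L₀, a, rfl, ha⟩
        · simp at ho
        · have haL : inv' a ≤ ret a := hLs a (by simp)
          rcases List.mem_append.1 ho with ho | ho
          · have h := (List.pairwise_append.1 (List.pairwise_append.1 hord).1).2.2 o ho a (by simp)
            omega
          · rw [List.mem_singleton.1 ho]
            omega
      have hB' : ∀ o ∈ L₁, inv o ≤ ret (push y) := by
        intro o ho
        by_contra hcon
        have := (hlate o (by simp [ho]) (not_le.1 hcon)).2
        have := hB o ho
        omega
      refine ⟨L₁ ++ push y :: pop y :: L₂, ?_, ?_, ?_, hval.insert_pair y⟩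
      · rw [List.nodup_middle, List.nodup_cons, List.nodup_middle, List.nodup_cons]
        simp only [List.mem_append, List.mem_cons] at *
        refine ⟨?_, hqn, hnd⟩
        rintro (h | h | h)
        · exact hpn (Or.inl h)
        · cases h
        · exact hpn (Or.inr h)
      · intro o
        have := hmem o
        rcases o with p | p | e
        · simp only [List.mem_append, List.mem_cons, Mem, Finset.mem_insert, push.injEq,
            reduceCtorEq, false_or] at *
          tauto
        · simp only [List.mem_append, List.mem_cons, Mem, Finset.mem_insert, pop.injEq,
            reduceCtorEq, false_or] at *
          constructor
          · rintro (h | rfl | h)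
            · tauto
            · tauto
            · tauto
          · tauto
        · simp only [List.mem_append, List.mem_cons, Mem, reduceCtorEq, false_or] at *
          tauto
      · obtain ⟨p₁, p₂, p₁₂⟩ := List.pairwise_append.1 hord'
        refine List.pairwise_append.2 ⟨p₁, ?_, ?_⟩
        · refine List.Pairwise.cons ?_ (List.Pairwise.cons ?_ p₂)
          · intro o ho
            rcases List.mem_cons.1 ho with rfl | ho
            · omega
            · have := h₂ o ho
              omega
          · intro o ho
            have := h₂ o ho
            omega
        · intro a ha b hb
          have h3 := hB a ha
          have h4 := hle a
          have h5 := hB' a ha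
          rcases List.mem_cons.1 hb with rfl | hb
          · omega
          rcases List.mem_cons.1 hb with rfl | hb
          · omega
          exact p₁₂ a ha b hb
    · refine ⟨L ++ [push y], ?_, ?_, ?_, hval.append_push y⟩
      · rw [List.nodup_append]
        refine ⟨hnd, by simp, ?_⟩
        intro a ha b hb hab
        rw [List.mem_singleton.1 hb] at hab
        exact hpn (hab ▸ ha)
      · intro o
        have := hmem o
        rcases o with p | p | e
        · simp only [List.mem_append, List.mem_singleton, Mem, Finset.mem_insert, push.injEq] at *
          tauto
        · simp only [List.mem_append, List.mem_singleton, Mem, Finset.mem_insert,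
            reduceCtorEq, or_false] at *
          constructor
          · tauto
          · rintro ⟨rfl | h, h'⟩
            · exact absurd h' hpy
            · tauto
        · simp only [List.mem_append, List.mem_singleton, Mem, reduceCtorEq, or_false] at *
          tauto
      · refine List.pairwise_append.2 ⟨hord', by simp, ?_⟩
        intro a ha b hb
        rw [List.mem_singleton.1 hb]
        intro h
        exact hpy (hlate a ha h).1
section StepLemmas

variable {n : ℕ} {d d' : Config n} {i j : Fin n}

theorem Step.time_eq (h : Step d i d') : d'.time = d.time + 1 := by
  cases h <;> rfl

theorem Step.top_le (h : Step d i d') : d.top ≤ d'.top := by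
  cases h <;> simp

theorem Step.proc_of_ne (h : Step d i d') (hj : j ≠ i) : d'.proc j = d.proc j := by
  cases h <;> simp [hj]

theorem Step.pend_of_ne (h : Step d i d') (hj : j ≠ i) : d'.pend j = d.pend j := by
  cases h <;> simp [hj]

/-- How a step changes an entry of `Items`. -/
theorem Step.items_cases (h : Step d i d') (r s : ℕ) :
    d'.items r s = d.items r s ∨
    (∃ x, d.proc i = PS.push3 x r ∧ s = (i : ℕ) + 1 ∧ d'.items r s = some x) ∨
    (∃ x, d.proc i = PS.popFound r s x ∧ d'.items r s = none) := by
  cases h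
  case pushWrite x t h =>
    by_cases hc : r = t ∧ s = (i : ℕ) + 1
    · obtain ⟨rfl, rfl⟩ := hc
      exact Or.inr (Or.inl ⟨x, h, rfl, by simp⟩)
    · exact Or.inl (by simp [hc])
  case popWrite r' s' x h =>
    by_cases hc : r = r' ∧ s = s'
    · obtain ⟨rfl, rfl⟩ := hc
      exact Or.inr (Or.inr ⟨x, h, by simp⟩)
    · exact Or.inl (by simp [hc])
  all_goals exact Or.inl rfl

theorem Step.items_of_push3 (h : Step d i d') {x t : ℕ} (hp : d.proc i = PS.push3 x t) :
    d'.items t ((i : ℕ) + 1) = some x ∧ d'.proc i = PS.done StackRes.ok := by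
  cases h <;> simp_all

theorem Step.items_of_popFound (h : Step d i d') {r s x : ℕ}
    (hp : d.proc i = PS.popFound r s x) :
    d'.items r s = none ∧ d'.proc i = PS.done (StackRes.val x) := by
  cases h <;> simp_all

/-- The pending operation changes only from none to one invoked now, or from a pending
operation with a computed result, which is then logged, to none. -/
theorem Step.pend_cases (h : Step d i d') :
    (d'.pend i = d.pend i ∧ d'.log = d.log ∧ ∀ res, d.proc i ≠ PS.done res) ∨
    (d.pend i = none ∧ d'.log = d.log ∧ (∀ res, d.proc i ≠ PS.done res) ∧
      ∃ op, d'.pend i = some (op, d.time)) ∨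
    (∃ op t₀ res, d.pend i = some (op, t₀) ∧ d.proc i = PS.done res ∧ d'.pend i = none ∧
      d'.log = d.log ++ [⟨i, op, res, t₀, d.time⟩]) := by
  cases h <;> simp_all

/-- The steps at which the result of an operation is computed. -/
theorem Step.done_cases (h : Step d i d') {res : StackRes}
    (h0 : ∀ r, d.proc i ≠ PS.done r) (h1 : d'.proc i = PS.done res) :
    (∃ x t, d.proc i = PS.push3 x t ∧ res = StackRes.ok) ∨
    (∃ r s x, d.proc i = PS.popFound r s x ∧ res = StackRes.val x) ∨
    (res = StackRes.empty ∧ (d.proc i = PS.pop1 ∧ d.top ≤ 1 ∨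
      d.proc i = PS.popScan 1 1 ∧ d.items 1 1 = none)) := by
  cases h <;> simp_all

/-- A measure of the number of own steps left before an operation responds. -/
def PS.rank (n : ℕ) : PS → ℕ ×ₗ ℕ
  | .idle => toLex (0, 0)
  | .push1 _ => toLex (0, 4)
  | .push2 _ _ => toLex (0, 3)
  | .push3 _ _ => toLex (0, 2)
  | .pop1 => toLex (1, 0)
  | .popScan r s => toLex (0, r * n + s + 3)
  | .popFound _ _ _ => toLex (0, 2)
  | .done _ => toLex (0, 1)

theorem Step.rank_lt (h : Step d i d') (hp : d.pend i ≠ none) (hp' : d'.pend i ≠ none) :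
    (d'.proc i).rank n < (d.proc i).rank n := by
  cases h
  case popRead_miss_row r hr h hx =>
    obtain ⟨r, rfl⟩ : ∃ k, r = k + 1 := ⟨r - 1, by omega⟩
    simp [*, PS.rank, Prod.Lex.toLex_lt_toLex, Nat.add_mul]
  all_goals
    simp_all [PS.rank, Prod.Lex.toLex_lt_toLex]
  all_goals omega

end StepLemmas

theorem Run.exists_respond {n : ℕ} {c : ℕ → Config n} {sched : ℕ → Fin n} (hR : Run c sched)
    {i : Fin n} (hi : ∀ k, ∃ k' ≥ k, sched k' = i) (k : ℕ) (hk : (c k).pend i ≠ none) :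
    ∃ k' > k, (c k').pend i = none := by
  by_contra! hcon
  have hpend : ∀ k' ≥ k, (c k').pend i ≠ none := by
    intro k' hk'
    rcases hk'.eq_or_lt with rfl | h
    · exact hk
    · exact hcon k' h
  have hstay : ∀ a b, a ≤ b → (∀ m, a ≤ m → m < b → sched m ≠ i) →
      (c b).proc i = (c a).proc i := by
    intro a b hab
    induction b, hab using Nat.le_induction with
    | base => intro _; rfl
    | succ b hab ih =>
      intro h
      rw [(hR.2 b).proc_of_ne (Ne.symm (h b hab (by omega)))]
      exact ih fun m h1 h2 => h m h1 (by omega)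
  have key : ∀ (v : ℕ ×ₗ ℕ) (k' : ℕ), k ≤ k' → ((c k').proc i).rank n ≠ v := by
    intro v
    induction v using WellFoundedLT.induction with
    | ind v ih =>
      rintro k' hk' rfl
      classical
      have hex := hi k'
      obtain ⟨h1, h2⟩ := Nat.find_spec hex
      have hst := hR.2 (Nat.find hex)
      rw [h2] at hst
      have hlt := hst.rank_lt (hpend _ (by omega)) (hpend _ (by omega))
      rw [hstay k' (Nat.find hex) h1 fun m h3 h4 h5 => Nat.find_min hex h4 ⟨h3, h5⟩] at hlt
      exact ih _ hlt _ (by omega) rfl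
  exact key _ k le_rfl rfl
/-- The content of the entry of `Items` at a position; positions are ordered
lexicographically by row and column. -/
def Config.cell {n : ℕ} (d : Config n) (y : ℕ ×ₗ ℕ) : Option ℕ :=
  d.items (ofLex y).1 (ofLex y).2

/-- Process `i` computes the result `res` of its operation `op`, invoked at time `t₀`,
in step `e`. -/
structure Finish {n : ℕ} (c : ℕ → Config n) (sched : ℕ → Fin n) (e : ℕ) (i : Fin n)
    (op : StackOp) (t₀ : ℕ) (res : StackRes) : Prop where
  sched_eq : sched e = i
  pend : (c e).pend i = some (op, t₀)
  not_done : ∀ r, (c e).proc i ≠ PS.done r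
  done : (c (e + 1)).proc i = PS.done res

/-- All positions above `q` have been read between the times `lo` and `k`, in decreasing
order, the position `y` at time `ρ y`, and have been found empty. -/
structure Scanned {n : ℕ} (c : ℕ → Config n) (lo k : ℕ) (q : ℕ ×ₗ ℕ)
    (ρ : ℕ ×ₗ ℕ → ℕ) : Prop where
  lo_le : ∀ y, q < y → lo ≤ ρ y
  le_hi : ∀ y, q < y → ρ y ≤ k
  absent : ∀ y, q < y → (c (ρ y)).cell y = none
  anti : ∀ y z, q < y → y ≤ z → ρ z ≤ ρ y

theorem Scanned.mono {n : ℕ} {c : ℕ → Config n} {lo k k' : ℕ} {q : ℕ ×ₗ ℕ}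
    {ρ : ℕ ×ₗ ℕ → ℕ} (h : Scanned c lo k q ρ) (hk : k ≤ k') : Scanned c lo k' q ρ :=
  ⟨h.lo_le, fun y hy => (h.le_hi y hy).trans hk, h.absent, h.anti⟩

theorem Scanned.extend {n : ℕ} {c : ℕ → Config n} {lo k : ℕ} {q q' : ℕ ×ₗ ℕ}
    {ρ : ℕ ×ₗ ℕ → ℕ} (h : Scanned c lo k q ρ) (hlo : lo ≤ k)
    (h' : ∀ y, q' < y → y ≤ q → (c k).cell y = none) :
    ∃ ρ', Scanned c lo k q' ρ' := by
  refine ⟨fun y => if q < y then ρ y else k, ?_, ?_, ?_, ?_⟩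
  · intro y _
    by_cases hq : q < y
    · simpa [hq] using h.lo_le y hq
    · simpa [hq] using hlo
  · intro y _
    by_cases hq : q < y
    · simpa [hq] using h.le_hi y hq
    · simp [hq]
  · intro y hy
    by_cases hq : q < y
    · simpa [hq] using h.absent y hq
    · simpa [hq] using h' y hy (not_lt.1 hq)
  · intro y z hy hyz
    by_cases hq : q < y
    · simpa [hq, hq.trans_le hyz] using h.anti y z hq hyz
    · by_cases hz : q < z
      · simpa [hq, hz] using h.le_hi z hz
      · simp [hq, hz]

/-- Invariant of process `i` in its local state at time `k`. -/
def LocalInv {n : ℕ} (c : ℕ → Config n) (sched : ℕ → Fin n) (k : ℕ) (i : Fin n) : PS → Prop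
  | .idle => (c k).pend i = none
  | .push1 x => ∃ t₀, (c k).pend i = some (StackOp.push x, t₀)
  | .push2 x t => ∃ t₀, (c k).pend i = some (StackOp.push x, t₀) ∧
      (∃ a, t₀ ≤ a ∧ (c a).top = t) ∧ 1 ≤ t ∧ t ≤ (c k).top ∧
      ∀ k' ≤ k, (c k').items t ((i : ℕ) + 1) = none
  | .push3 x t => ∃ t₀, (c k).pend i = some (StackOp.push x, t₀) ∧
      (∃ a, t₀ ≤ a ∧ (c a).top = t) ∧ 1 ≤ t ∧ t < (c k).top ∧
      ∀ k' ≤ k, (c k').items t ((i : ℕ) + 1) = none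
  | .pop1 => ∃ t₀, (c k).pend i = some (StackOp.pop, t₀)
  | .popScan r s => ∃ t₀ ρ, (c k).pend i = some (StackOp.pop, t₀) ∧ 1 ≤ r ∧ 1 ≤ s ∧ s ≤ n ∧
      Scanned c t₀ k (toLex (r, s)) ρ
  | .popFound r s x => ∃ t₀ ρ rt, (c k).pend i = some (StackOp.pop, t₀) ∧ rt < k ∧ t₀ < rt ∧
      Scanned c t₀ rt (toLex (r, s)) ρ ∧ (c rt).items r s = some x
  | .done res => ∃ op t₀ e, (c k).pend i = some (op, t₀) ∧ e < k ∧
      Finish c sched e i op t₀ res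

section Trace

variable {n : ℕ} {c : ℕ → Config n} {sched : ℕ → Fin n}

theorem Run.time_eq (hR : Run c sched) (k : ℕ) : (c k).time = k := by
  induction k with
  | zero => rw [hR.1]; rfl
  | succ k ih => rw [(hR.2 k).time_eq, ih]

theorem Run.top_mono (hR : Run c sched) : Monotone fun k => (c k).top :=
  monotone_nat_of_le_succ fun k => (hR.2 k).top_le

theorem Run.pend_persists (hR : Run c sched) {k : ℕ} {i : Fin n} {op : StackOp} {t₀ : ℕ}
    (h : (c k).pend i = some (op, t₀)) :
    t₀ < k ∧ sched t₀ = i ∧ ∀ k', t₀ < k' → k' ≤ k → (c k').pend i = some (op, t₀) := by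
  induction k with
  | zero => rw [hR.1] at h; simp [initConfig] at h
  | succ k ih =>
    have hext : (c k).pend i = some (op, t₀) → t₀ < k + 1 ∧ sched t₀ = i ∧
        ∀ k', t₀ < k' → k' ≤ k + 1 → (c k').pend i = some (op, t₀) := by
      intro h'
      obtain ⟨h1, h2, h3⟩ := ih h'
      refine ⟨by omega, h2, fun k' h4 h5 => ?_⟩
      rcases h5.eq_or_lt with rfl | h5
      · exact h
      · exact h3 k' h4 (by omega)
    by_cases hi : i = sched k
    · subst hi
      rcases (hR.2 k).pend_cases with h' | ⟨-, -, -, op', h'⟩ | ⟨_, _, _, -, -, h', -⟩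
      · exact hext (h'.1 ▸ h)
      · rw [h', hR.time_eq] at h
        simp only [Option.some.injEq, Prod.mk.injEq] at h
        obtain ⟨rfl, rfl⟩ := h
        refine ⟨by omega, rfl, fun k' h1 h2 => ?_⟩
        obtain rfl : k' = k + 1 := by omega
        rw [h', hR.time_eq]
      · simp [h'] at h
    · exact hext ((hR.2 k).pend_of_ne hi ▸ h)

/-- A step of another process preserves the local invariant. -/
theorem Run.localInv_of_ne (hR : Run c sched) {k : ℕ} {i : Fin n} (hi : i ≠ sched k)
    {p : PS} (h : LocalInv c sched k i p) : LocalInv c sched (k + 1) i p := by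
  have hp := (hR.2 k).pend_of_ne hi
  have ht := (hR.2 k).top_le
  have hfresh : ∀ t, (∀ k' ≤ k, (c k').items t ((i : ℕ) + 1) = none) →
      ∀ k' ≤ k + 1, (c k').items t ((i : ℕ) + 1) = none := by
    intro t hf k' hk'
    rcases hk'.eq_or_lt with rfl | hk'
    · rcases (hR.2 k).items_cases t ((i : ℕ) + 1) with h | ⟨x, -, h, -⟩ | ⟨x, -, h⟩
      · rw [h]; exact hf k le_rfl
      · exact absurd (Fin.ext (by omega)) hi
      · exact h
    · exact hf k' (by omega)
  cases p <;> simp only [LocalInv, hp] at h ⊢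
  case idle => exact h
  case push1 => exact h
  case push2 =>
    obtain ⟨t₀, h1, h2, h3, h4, h5⟩ := h
    exact ⟨t₀, h1, h2, h3, by omega, hfresh _ h5⟩
  case push3 =>
    obtain ⟨t₀, h1, h2, h3, h4, h5⟩ := h
    exact ⟨t₀, h1, h2, h3, by omega, hfresh _ h5⟩
  case pop1 => exact h
  case popScan =>
    obtain ⟨t₀, ρ, h1, h2, h3, h4, h5⟩ := h
    exact ⟨t₀, ρ, h1, h2, h3, h4, h5.mono (by omega)⟩
  case popFound =>
    obtain ⟨t₀, ρ, rt, h1, h2, h3⟩ := h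
    exact ⟨t₀, ρ, rt, h1, by omega, h3⟩
  case done =>
    obtain ⟨op, t₀, e, h1, h2, h3⟩ := h
    exact ⟨op, t₀, e, h1, by omega, h3⟩

/-- Bounds on the counter and on the positions of the nonempty entries up to time `k`. -/
structure GlobalInv (c : ℕ → Config n) (k : ℕ) : Prop where
  one_le : 1 ≤ (c k).top
  bounds : ∀ k' ≤ k, ∀ r s, (c k').items r s ≠ none →
    1 ≤ r ∧ r < (c k).top ∧ 1 ≤ s ∧ s ≤ n

theorem Run.globalInv_succ (hR : Run c sched) {k : ℕ} (hG : GlobalInv c k)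
    (hL : LocalInv c sched k (sched k) ((c k).proc (sched k))) : GlobalInv c (k + 1) := by
  have ht := (hR.2 k).top_le
  refine ⟨hG.one_le.trans ht, fun k' hk' r s h => ?_⟩
  rcases hk'.eq_or_lt with rfl | hk'
  · rcases (hR.2 k).items_cases r s with h' | ⟨x, hp, hs, -⟩ | ⟨x, -, h'⟩
    · have := hG.bounds k le_rfl r s (h' ▸ h)
      omega
    · rw [hp] at hL
      obtain ⟨-, -, -, h1, h2, -⟩ := hL
      have := (sched k).isLt
      omega
    · exact absurd h' h
  · have := hG.bounds k' (by omega) r s h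
    omega

theorem Run.localInv_succ_self (hR : Run c sched) {k : ℕ} (hG : GlobalInv c k)
    (hL : LocalInv c sched k (sched k) ((c k).proc (sched k))) :
    LocalInv c sched (k + 1) (sched k) ((c (k + 1)).proc (sched k)) := by
  have hfin : ∀ res op t₀, (∀ r, (c k).proc (sched k) ≠ PS.done r) →
      (c (k + 1)).proc (sched k) = PS.done res →
      (c k).pend (sched k) = some (op, t₀) →
      (c (k + 1)).pend (sched k) = some (op, t₀) →
      LocalInv c sched (k + 1) (sched k) (PS.done res) :=
    fun res op t₀ h1 h2 h3 h4 => ⟨op, t₀, k, h4, by omega, rfl, h3, h1, h2⟩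
  have hst := hR.2 k
  have hG' := hR.globalInv_succ hG hL
  have hout : ∀ y : ℕ ×ₗ ℕ, ((ofLex y).1 < 1 ∨ (c k).top ≤ (ofLex y).1 ∨ (ofLex y).2 < 1 ∨
      n < (ofLex y).2) → (c k).cell y = none := by
    intro y hy
    by_contra hcon
    have := hG.bounds k le_rfl _ _ hcon
    omega
  generalize hi : sched k = i at *
  generalize hd : c k = d at hst
  generalize hd' : c (k + 1) = d' at hst
  cases hst
  case invPush x h hp =>
    simp only [hd', Function.update_self, LocalInv]
    exact ⟨_, rfl⟩
  case invPop h hp =>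
    simp only [hd', Function.update_self, LocalInv]
    exact ⟨_, rfl⟩
  case pushReadTop x h =>
    rw [hd, h] at hL
    obtain ⟨t₀, h1⟩ := hL
    have h0 := (hR.pend_persists h1).1
    rw [hd] at h1
    simp only [hd', Function.update_self, LocalInv]
    refine ⟨t₀, h1, ⟨k, h0.le, by rw [hd]⟩, ?_, le_rfl, ?_⟩
    · simpa [hd] using hG.one_le
    · intro k' hk'
      by_contra hcon
      have := hG'.bounds k' hk' _ _ hcon
      simp [hd'] at this
  case pushIncTop x t h =>
    rw [hd, h] at hL
    obtain ⟨t₀, h1, h2, h3, h4, h5⟩ := hL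
    rw [hd] at h1 h4
    simp only [hd', Function.update_self, LocalInv]
    refine ⟨t₀, h1, h2, h3, by omega, ?_⟩
    intro k' hk'
    rcases hk'.eq_or_lt with rfl | hk'
    · have := h5 k le_rfl
      rw [hd] at this
      rw [hd']
      exact this
    · exact h5 k' (by omega)
  case pushWrite x t h =>
    rw [hd, h] at hL
    obtain ⟨t₀, h1, -⟩ := hL
    simp only [Function.update_self]
    refine hfin _ _ t₀ (by simp [hd, h]) (by simp [hd']) h1 ?_
    rw [hd']
    simpa [hd] using h1
  case popReadTop_pos h ht =>
    rw [hd, h] at hL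
    obtain ⟨t₀, h1⟩ := hL
    have h0 := (hR.pend_persists h1).1
    have hn : 1 ≤ n := by have := i.isLt; omega
    rw [hd] at h1
    simp only [hd', Function.update_self, LocalInv]
    refine ⟨t₀, fun _ => k, h1, by omega, hn, le_rfl, ?_, ?_, ?_, ?_⟩
    · intro _ _; exact h0.le
    · intro _ _; simp
    · intro y hy
      refine hout y ?_
      rw [Prod.Lex.lt_iff] at hy
      simp only [ofLex_toLex, hd] at hy ⊢
      omega
    · intro _ _ _ _; exact le_rfl
  case popReadTop_empty h ht =>
    rw [hd, h] at hL
    obtain ⟨t₀, h1⟩ := hL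
    simp only [Function.update_self]
    refine hfin _ _ t₀ (by simp [hd, h]) (by simp [hd']) h1 ?_
    rw [hd']
    simpa [hd] using h1
  case popRead_found r s x h hx =>
    rw [hd, h] at hL
    obtain ⟨t₀, ρ, h1, -, -, -, h2⟩ := hL
    have h0 := (hR.pend_persists h1).1
    rw [hd] at h1
    simp only [hd', Function.update_self, LocalInv]
    exact ⟨t₀, ρ, k, h1, by omega, h0, h2, by rw [hd]; exact hx⟩
  case popRead_miss_col r s h hx hs =>
    rw [hd, h] at hL
    obtain ⟨t₀, ρ, h1, hr, hs1, hsn, h2⟩ := hL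
    have h0 := (hR.pend_persists h1).1
    rw [hd] at h1
    obtain ⟨ρ', h3⟩ := h2.extend (q' := toLex (r, s - 1)) h0.le (by
      intro y hy hy'
      rw [Prod.Lex.lt_iff] at hy
      rw [Prod.Lex.le_iff] at hy'
      simp only [ofLex_toLex] at hy hy'
      have e1 : (ofLex y).1 = r := by omega
      have e2 : (ofLex y).2 = s := by omega
      rw [Config.cell, e1, e2, hd, hx])
    simp only [hd', Function.update_self, LocalInv]
    exact ⟨t₀, ρ', h1, hr, by omega, by omega, h3.mono (by omega)⟩
  case popRead_miss_row r h hx hr2 =>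
    rw [hd, h] at hL
    obtain ⟨t₀, ρ, h1, hr, hs1, hsn, h2⟩ := hL
    have h0 := (hR.pend_persists h1).1
    rw [hd] at h1
    obtain ⟨ρ', h3⟩ := h2.extend (q' := toLex (r - 1, n)) h0.le (by
      intro y hy hy'
      rw [Prod.Lex.lt_iff] at hy
      rw [Prod.Lex.le_iff] at hy'
      simp only [ofLex_toLex] at hy hy'
      by_cases hc : (ofLex y).1 = r ∧ (ofLex y).2 = 1
      · rw [Config.cell, hc.1, hc.2, hd, hx]
      · exact hout y (by omega))
    simp only [hd', Function.update_self, LocalInv]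
    exact ⟨t₀, ρ', h1, by omega, by omega, le_rfl, h3.mono (by omega)⟩
  case popRead_miss_end h hx =>
    rw [hd, h] at hL
    obtain ⟨t₀, ρ, h1, -⟩ := hL
    simp only [Function.update_self]
    refine hfin _ _ t₀ (by simp [hd, h]) (by simp [hd']) h1 ?_
    rw [hd']
    simpa [hd] using h1
  case popWrite r s x h =>
    rw [hd, h] at hL
    obtain ⟨t₀, ρ, rt, h1, -⟩ := hL
    simp only [Function.update_self]
    refine hfin _ _ t₀ (by simp [hd, h]) (by simp [hd']) h1 ?_
    rw [hd']
    simpa [hd] using h1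
  case respond res op t₀ h hp =>
    simp only [hd', Function.update_self, LocalInv]

theorem Run.inv (hR : Run c sched) (k : ℕ) :
    GlobalInv c k ∧ ∀ i, LocalInv c sched k i ((c k).proc i) := by
  induction k with
  | zero =>
    refine ⟨⟨by simp [hR.1, initConfig], ?_⟩, ?_⟩
    · intro k' hk' r s h
      obtain rfl : k' = 0 := by omega
      simp [hR.1, initConfig] at h
    · intro i
      simp [hR.1, initConfig, LocalInv]
  | succ k ih =>
    refine ⟨hR.globalInv_succ ih.1 (ih.2 _), fun i => ?_⟩
    by_cases hi : i = sched k
    · subst hi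
      exact hR.localInv_succ_self ih.1 (ih.2 _)
    · rw [(hR.2 k).proc_of_ne hi]
      exact hR.localInv_of_ne hi (ih.2 i)

/-- Properties of the log at time `k`. -/
structure LogInv (c : ℕ → Config n) (sched : ℕ → Fin n) (k : ℕ) : Prop where
  pairwise : (c k).log.Pairwise fun a b => a.retT < b.retT
  entry : ∀ a ∈ (c k).log, a.retT < k ∧
    (∃ e < a.retT, Finish c sched e a.proc a.op a.invT a.res) ∧
    (c a.retT).pend a.proc = some (a.op, a.invT) ∧ (c (a.retT + 1)).pend a.proc = none

theorem Run.logInv (hR : Run c sched) (k : ℕ) : LogInv c sched k := by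
  induction k with
  | zero =>
    constructor
    · simp [hR.1, initConfig]
    · intro a ha
      simp [hR.1, initConfig] at ha
  | succ k ih =>
    have hmono : (c (k + 1)).log = (c k).log → LogInv c sched (k + 1) := by
      intro h
      refine ⟨h ▸ ih.pairwise, fun a ha => ?_⟩
      obtain ⟨h1, h2⟩ := ih.entry a (h ▸ ha)
      exact ⟨by omega, h2⟩
    rcases (hR.2 k).pend_cases with h | h | ⟨op, t₀, res, hp, hd, hn, hl⟩
    · exact hmono h.2.1
    · exact hmono h.2.1
    · rw [hR.time_eq] at hl
      constructor
      · rw [hl]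
        refine List.pairwise_append.2 ⟨ih.pairwise, by simp, ?_⟩
        intro a ha b hb
        rw [List.mem_singleton.1 hb]
        exact (ih.entry a ha).1
      · intro a ha
        rw [hl] at ha
        rcases List.mem_append.1 ha with ha | ha
        · obtain ⟨h1, h2⟩ := ih.entry a ha
          exact ⟨by omega, h2⟩
        · rw [List.mem_singleton.1 ha]
          have := (hR.inv k).2 (sched k)
          rw [hd] at this
          obtain ⟨op', t', e, h1, h2, h3⟩ := this
          rw [hp] at h1
          simp only [Option.some.injEq, Prod.mk.injEq] at h1
          obtain ⟨rfl, rfl⟩ := h1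
          exact ⟨by simp, ⟨e, h2, h3⟩, hp, hn⟩

/-- An operation in the log is not pending any more. -/
theorem Run.log_invT_ne (hR : Run c sched) {k : ℕ} {a : LogEntry n} (ha : a ∈ (c k).log)
    {k' : ℕ} (hk : a.retT < k') {i : Fin n} {op : StackOp} {t₀ : ℕ}
    (h : (c k').pend i = some (op, t₀)) : a.invT ≠ t₀ := by
  rintro rfl
  obtain ⟨-, -, h1, h2⟩ := (hR.logInv k).entry a ha
  obtain ⟨h3, h4, -⟩ := hR.pend_persists h1
  obtain ⟨-, h5, h6⟩ := hR.pend_persists h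
  obtain rfl : a.proc = i := by rw [← h4, h5]
  rw [h6 (a.retT + 1) (by omega) (by omega)] at h2
  cases h2

theorem Finish.pending_or_logged (hR : Run c sched) {e k : ℕ} {i : Fin n} {op : StackOp}
    {t₀ : ℕ} {res : StackRes} (h : Finish c sched e i op t₀ res) (hk : e < k) :
    ((c k).pend i = some (op, t₀) ∧ (c k).proc i = PS.done res) ∨
    ∃ a ∈ (c k).log, a.op = op ∧ a.invT = t₀ ∧ a.res = res := by
  induction k, hk using Nat.le_induction with
  | base =>
    refine Or.inl ⟨?_, h.done⟩
    have hs := (hR.2 e).pend_cases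
    rw [h.sched_eq] at hs
    rcases hs with h' | h' | ⟨_, _, res', -, h', -⟩
    · rw [h'.1, h.pend]
    · rw [h.pend] at h'
      simp at h'
    · exact absurd h' (h.not_done _)
  | succ k hk ih =>
    rcases ih with ⟨h1, h2⟩ | ⟨a, ha, h1⟩
    · by_cases hi : i = sched k
      · subst hi
        rcases (hR.2 k).pend_cases with h' | h' | ⟨op', t', res', hp, hd, hn, hl⟩
        · exact absurd h2 (h'.2.2 _)
        · exact absurd h2 (h'.2.2.1 _)
        · rw [h1] at hp
          rw [h2] at hd
          simp only [Option.some.injEq, Prod.mk.injEq, PS.done.injEq] at hp hd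
          obtain ⟨rfl, rfl⟩ := hp
          subst hd
          right
          rw [hl]
          exact ⟨_, List.mem_append_right _ (List.mem_singleton_self _), rfl, rfl, rfl⟩
      · left
        rw [(hR.2 k).pend_of_ne hi, (hR.2 k).proc_of_ne hi]
        exact ⟨h1, h2⟩
    · right
      refine ⟨a, ?_, h1⟩
      rcases (hR.2 k).pend_cases with h' | h' | ⟨op', t', res', -, -, -, hl⟩
      · rwa [h'.2.1]
      · rwa [h'.2.1]
      · rw [hl]; exact List.mem_append_left _ ha

theorem Finish.not_lt (hR : Run c sched) {e e' : ℕ} {i i' : Fin n} {op op' : StackOp}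
    {t₀ : ℕ} {res res' : StackRes} (h : Finish c sched e i op t₀ res)
    (h' : Finish c sched e' i' op' t₀ res') : ¬ e < e' := by
  intro hlt
  obtain ⟨-, h1, -⟩ := hR.pend_persists h.pend
  obtain ⟨-, h2, -⟩ := hR.pend_persists h'.pend
  obtain rfl : i = i' := by rw [← h1, h2]
  rcases h.pending_or_logged hR hlt with h3 | ⟨a, ha, -, h3, -⟩
  · exact h'.not_done _ h3.2
  · exact hR.log_invT_ne ha ((hR.logInv e').entry a ha).1 h'.pend h3

theorem Finish.unique (hR : Run c sched) {e e' : ℕ} {i i' : Fin n} {op op' : StackOp}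
    {t₀ : ℕ} {res res' : StackRes} (h : Finish c sched e i op t₀ res)
    (h' : Finish c sched e' i' op' t₀ res') : e = e' ∧ i = i' ∧ res = res' := by
  have h1 := h.not_lt hR h'
  have h2 := h'.not_lt hR h
  obtain rfl : e = e' := by omega
  obtain rfl : i = i' := by rw [← h.sched_eq, h'.sched_eq]
  have h3 := h.done
  rw [h'.done] at h3
  exact ⟨rfl, rfl, by simpa using h3.symm⟩

/-- Step `e` writes the item `x` at position `y`. -/
def Writes (c : ℕ → Config n) (sched : ℕ → Fin n) (y : ℕ ×ₗ ℕ) (e x : ℕ) : Prop :=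
  ∃ t, (c e).proc (sched e) = PS.push3 x t ∧ y = toLex (t, (sched e : ℕ) + 1)

/-- Step `e` erases position `y`, where the item `x` was read before. -/
def Erases (c : ℕ → Config n) (sched : ℕ → Fin n) (y : ℕ ×ₗ ℕ) (e x : ℕ) : Prop :=
  (c e).proc (sched e) = PS.popFound (ofLex y).1 (ofLex y).2 x

theorem Writes.finish (hR : Run c sched) {y : ℕ ×ₗ ℕ} {e x : ℕ} (h : Writes c sched y e x) :
    ∃ t₀, Finish c sched e (sched e) (StackOp.push x) t₀ StackRes.ok ∧ t₀ < e ∧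
      (∃ a, t₀ ≤ a ∧ (c a).top = (ofLex y).1) ∧ (ofLex y).1 < (c e).top := by
  obtain ⟨t, h, rfl⟩ := h
  have := (hR.inv e).2 (sched e)
  rw [h] at this
  obtain ⟨t₀, h1, h2, -, h3, -⟩ := this
  exact ⟨t₀, ⟨rfl, h1, by simp [h], ((hR.2 e).items_of_push3 h).2⟩,
    (hR.pend_persists h1).1, h2, h3⟩

theorem Erases.finish (hR : Run c sched) {y : ℕ ×ₗ ℕ} {e x : ℕ} (h : Erases c sched y e x) :
    ∃ t₀ ρ rt, Finish c sched e (sched e) StackOp.pop t₀ (StackRes.val x) ∧ rt < e ∧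
      t₀ < rt ∧ Scanned c t₀ rt y ρ ∧ (c rt).cell y = some x := by
  have := (hR.inv e).2 (sched e)
  rw [h] at this
  obtain ⟨t₀, ρ, rt, h1, h2, h3, h4, h5⟩ := this
  exact ⟨t₀, ρ, rt, ⟨rfl, h1, by simp [show _ = _ from h], ((hR.2 e).items_of_popFound h).2⟩,
    h2, h3, h4, h5⟩

theorem Finish.cases (hR : Run c sched) {e : ℕ} {i : Fin n} {op : StackOp}
    {t₀ : ℕ} {res : StackRes} (h : Finish c sched e i op t₀ res) :
    (∃ y x, Writes c sched y e x ∧ res = StackRes.ok) ∨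
    (∃ y x, Erases c sched y e x ∧ res = StackRes.val x) ∨
    (res = StackRes.empty ∧ op = StackOp.pop ∧ t₀ < e ∧
      ∃ ρ, Scanned c t₀ e (toLex (0, 0)) ρ) := by
  obtain ⟨rfl, hp, h0, h1⟩ := h
  have hlt := (hR.pend_persists hp).1
  have hout : ∀ y : ℕ ×ₗ ℕ, ((ofLex y).1 < 1 ∨ (c e).top ≤ (ofLex y).1 ∨ (ofLex y).2 < 1 ∨
      n < (ofLex y).2) → (c e).cell y = none := by
    intro y hy
    by_contra hcon
    have := (hR.inv e).1.bounds e le_rfl _ _ hcon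
    omega
  have hL := (hR.inv e).2 (sched e)
  rcases (hR.2 e).done_cases h0 h1 with
    ⟨x, t, h, rfl⟩ | ⟨r, s, x, h, rfl⟩ | ⟨rfl, ⟨h, ht⟩ | ⟨h, hx⟩⟩
  · exact Or.inl ⟨_, x, ⟨t, h, rfl⟩, rfl⟩
  · exact Or.inr (Or.inl ⟨toLex (r, s), x, h, rfl⟩)
  · rw [h] at hL
    obtain ⟨t, h2⟩ := hL
    rw [hp] at h2
    simp only [Option.some.injEq, Prod.mk.injEq] at h2
    obtain ⟨rfl, rfl⟩ := h2
    refine Or.inr (Or.inr ⟨rfl, rfl, hlt, fun _ => e, fun _ _ => hlt.le, fun _ _ => le_rfl,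
      fun y _ => hout y (by omega), fun _ _ _ _ => le_rfl⟩)
  · rw [h] at hL
    obtain ⟨t, ρ, h2, -, -, -, h3⟩ := hL
    rw [hp] at h2
    simp only [Option.some.injEq, Prod.mk.injEq] at h2
    obtain ⟨rfl, rfl⟩ := h2
    refine Or.inr (Or.inr ⟨rfl, rfl, hlt, h3.extend hlt.le ?_⟩)
    intro y _ hy'
    rw [Prod.Lex.le_iff] at hy'
    simp only [ofLex_toLex] at hy'
    by_cases hc : (ofLex y).1 = 1 ∧ (ofLex y).2 = 1
    · rw [Config.cell, hc.1, hc.2, hx]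
    · exact hout y (by omega)

theorem Run.cell_succ (hR : Run c sched) (k : ℕ) (y : ℕ ×ₗ ℕ) :
    (c (k + 1)).cell y = (c k).cell y ∨
    (∃ x, Writes c sched y k x ∧ (c (k + 1)).cell y = some x) ∨
    (∃ x, Erases c sched y k x ∧ (c (k + 1)).cell y = none) := by
  rcases (hR.2 k).items_cases (ofLex y).1 (ofLex y).2 with h | ⟨x, h1, h2, h3⟩ | h
  · exact Or.inl h
  · exact Or.inr (Or.inl ⟨x, ⟨_, h1, by rw [← h2]; rfl⟩, h3⟩)
  · exact Or.inr (Or.inr h)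

theorem Writes.cell_succ (hR : Run c sched) {y : ℕ ×ₗ ℕ} {e x : ℕ}
    (h : Writes c sched y e x) : (c (e + 1)).cell y = some x := by
  obtain ⟨t, h, rfl⟩ := h
  exact ((hR.2 e).items_of_push3 h).1

theorem Writes.cell_of_le (hR : Run c sched) {y : ℕ ×ₗ ℕ} {e x : ℕ}
    (h : Writes c sched y e x) {k : ℕ} (hk : k ≤ e) : (c k).cell y = none := by
  obtain ⟨t, h, rfl⟩ := h
  have := (hR.inv e).2 (sched e)
  rw [h] at this
  obtain ⟨t₀, -, -, -, -, h1⟩ := this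
  exact h1 k hk

theorem Writes.unique (hR : Run c sched) {y : ℕ ×ₗ ℕ} {e x e' x' : ℕ}
    (h : Writes c sched y e x) (h' : Writes c sched y e' x') : e = e' ∧ x = x' := by
  have key : ∀ {e x e' x'}, Writes c sched y e x → Writes c sched y e' x' → ¬ e < e' := by
    intro e x e' x' h h' hlt
    have := h'.cell_of_le hR (k := e + 1) hlt
    rw [h.cell_succ hR] at this
    cases this
  have h1 := key h h'
  have h2 := key h' h
  obtain rfl : e = e' := by omega
  have := h.cell_succ hR
  rw [h'.cell_succ hR] at this
  exact ⟨rfl, by simpa using this.symm⟩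

theorem Run.exists_writes (hR : Run c sched) {k : ℕ} {y : ℕ ×ₗ ℕ} {x : ℕ}
    (h : (c k).cell y = some x) : ∃ e < k, Writes c sched y e x := by
  induction k with
  | zero => simp [hR.1, initConfig, Config.cell] at h
  | succ k ih =>
    rcases hR.cell_succ k y with h' | ⟨x', h1, h2⟩ | ⟨x', -, h2⟩
    · obtain ⟨e, he, h1⟩ := ih (h' ▸ h)
      exact ⟨e, by omega, h1⟩
    · rw [h] at h2
      obtain rfl : x = x' := by simpa using h2
      exact ⟨k, by omega, h1⟩
    · rw [h] at h2
      cases h2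

/-- A written position keeps its item until it is first erased, and is empty afterwards. -/
theorem Writes.cell_cases (hR : Run c sched) {y : ℕ ×ₗ ℕ} {e x : ℕ}
    (h : Writes c sched y e x) {k : ℕ} (hk : e < k) :
    ((c k).cell y = some x ∧ ∀ w x', w < k → ¬ Erases c sched y w x') ∨
    ((c k).cell y = none ∧ ∃ w x', e < w ∧ w < k ∧ Erases c sched y w x') := by
  have hbefore : ∀ w x', w ≤ e → ¬ Erases c sched y w x' := by
    intro w x' hw hE
    obtain ⟨t₀, ρ, rt, -, h1, -, -, h2⟩ := hE.finish hR
    rw [h.cell_of_le hR (by omega)] at h2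
    cases h2
  induction k, hk using Nat.le_induction with
  | base => exact Or.inl ⟨h.cell_succ hR, fun w x' hw => hbefore w x' (by omega)⟩
  | succ k hk ih =>
    have hnw : ∀ x', ¬ Writes c sched y k x' := by
      intro x' h'
      have := (h.unique hR h').1
      omega
    rcases ih with ⟨h1, h2⟩ | ⟨h1, w, x', h2, h3, h4⟩
    · by_cases hE : ∃ x', Erases c sched y k x'
      · obtain ⟨x', hE⟩ := hE
        exact Or.inr ⟨((hR.2 k).items_of_popFound hE).1, k, x', by omega, by omega, hE⟩
      · left
        push Not at hE
        rcases hR.cell_succ k y with h' | ⟨x', h', -⟩ | ⟨x', h', -⟩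
        · refine ⟨h'.trans h1, fun w x' hw => ?_⟩
          rcases (Nat.lt_succ_iff.1 hw).eq_or_lt with rfl | hw
          · exact hE x'
          · exact h2 w x' hw
        · exact absurd h' (hnw x')
        · exact absurd h' (hE x')
    · right
      refine ⟨?_, w, x', h2, by omega, h4⟩
      rcases hR.cell_succ k y with h' | ⟨x', h', -⟩ | ⟨x', -, h'⟩
      · exact h'.trans h1
      · exact absurd h' (hnw x')
      · exact h'

/-- The read of an item by a pop lies between the write and every erasure of the position. -/
theorem Run.read_between (hR : Run c sched) {y : ℕ ×ₗ ℕ} {rt x : ℕ}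
    (h : (c rt).cell y = some x) :
    ∃ e < rt, Writes c sched y e x ∧ ∀ w x', Erases c sched y w x' → rt ≤ w := by
  obtain ⟨e, he, hw⟩ := hR.exists_writes h
  refine ⟨e, he, hw, fun w x' hE => ?_⟩
  rcases hw.cell_cases hR he with ⟨-, h1⟩ | ⟨h1, -⟩
  · by_contra hcon
    exact h1 w x' (by omega) hE
  · rw [h] at h1
    cases h1

end Trace

section History

theorem mem_pendingList {n : ℕ} {d : Config n} {p : StackOp × ℕ} :
    p ∈ pendingList d ↔ ∃ i, d.pend i = some p := by
  simp [pendingList]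

/-- An operation of the history is either logged or pending. -/
theorem historyAt_cases {n : ℕ} (d : Config n) (k : Fin (historyAt d).m) :
    (∃ a ∈ d.log, (historyAt d).op k = a.op ∧ (historyAt d).inv k = a.invT ∧
      (historyAt d).ret k = some a.retT ∧ (historyAt d).out k = some a.res) ∨
    (∃ i, d.pend i = some ((historyAt d).op k, (historyAt d).inv k) ∧
      (historyAt d).ret k = none ∧ (historyAt d).out k = none) := by
  by_cases hk : (k : ℕ) < d.log.length
  · left
    exact ⟨d.log.get ⟨k, hk⟩, List.get_mem _ _, by simp [historyAt, hk]⟩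
  · right
    have hk' : (k : ℕ) - d.log.length < (pendingList d).length := by
      have := k.isLt
      simp only [historyAt] at this
      omega
    obtain ⟨i, hi⟩ := mem_pendingList.1 (List.getElem_mem hk')
    refine ⟨i, ?_, by simp [historyAt, hk], by simp [historyAt, hk]⟩
    rw [hi]
    simp only [historyAt, dif_neg hk]
    simp [hk']

theorem exists_historyAt_of_log {n : ℕ} {d : Config n} {a : LogEntry n} (ha : a ∈ d.log) :
    ∃ k, (historyAt d).op k = a.op ∧ (historyAt d).inv k = a.invT := by
  obtain ⟨j, hj, rfl⟩ := List.getElem_of_mem ha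
  exact ⟨⟨j, by simp only [historyAt]; omega⟩, by simp [historyAt, hj]⟩

theorem exists_historyAt_of_pend {n : ℕ} {d : Config n} {i : Fin n} {op : StackOp} {t₀ : ℕ}
    (h : d.pend i = some (op, t₀)) :
    ∃ k, (historyAt d).op k = op ∧ (historyAt d).inv k = t₀ := by
  obtain ⟨j, hj, hj'⟩ := List.getElem_of_mem (mem_pendingList.2 ⟨i, h⟩)
  refine ⟨⟨d.log.length + j, by simp only [historyAt]; omega⟩, ?_⟩
  simp [historyAt, hj, hj']

variable {n : ℕ} {c : ℕ → Config n} {sched : ℕ → Fin n}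

theorem Run.pairwise_pendingList (hR : Run c sched) (N : ℕ) :
    (pendingList (c N)).Pairwise fun a b => a.2 ≠ b.2 := by
  rw [pendingList, List.pairwise_filterMap]
  refine (List.nodup_finRange n).imp ?_
  rintro i j hij ⟨op, t⟩ h ⟨op', t'⟩ h' rfl
  have h1 := (hR.pend_persists h).2.1
  have h2 := (hR.pend_persists h').2.1
  exact hij (h1.symm.trans h2)

theorem Run.pairwise_log (hR : Run c sched) (N : ℕ) :
    (c N).log.Pairwise fun a b => a.invT ≠ b.invT := by
  refine (hR.logInv N).pairwise.imp_of_mem ?_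
  intro a b ha hb hab
  exact hR.log_invT_ne ha hab ((hR.logInv N).entry b hb).2.2.1

theorem Run.historyAt_inv_injective (hR : Run c sched) (N : ℕ) :
    Function.Injective (historyAt (c N)).inv := by
  let l : List ℕ := (c N).log.map (fun a => a.invT) ++ (pendingList (c N)).map Prod.snd
  have hl : l.Nodup := by
    refine List.pairwise_append.2 ⟨?_, ?_, ?_⟩
    · rw [List.pairwise_map]; exact hR.pairwise_log N
    · rw [List.pairwise_map]; exact hR.pairwise_pendingList N
    · intro a ha b hb
      obtain ⟨a, ha', rfl⟩ := List.mem_map.1 ha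
      obtain ⟨b, hb', rfl⟩ := List.mem_map.1 hb
      obtain ⟨i, hi⟩ := mem_pendingList.1 hb'
      exact hR.log_invT_ne ha' ((hR.logInv N).entry a ha').1 hi
  have hlen : l.length = (historyAt (c N)).m := by simp [l, historyAt]
  have hinv : ∀ k : Fin (historyAt (c N)).m,
      (historyAt (c N)).inv k = l[(k : ℕ)]'(by rw [hlen]; exact k.isLt) := by
    intro k
    have hk' := k.isLt
    simp only [historyAt] at hk'
    by_cases hk : (k : ℕ) < (c N).log.length
    · simp [historyAt, l, hk]
    · have : (k : ℕ) - (c N).log.length < (pendingList (c N)).length := by omega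
      simp [historyAt, l, hk, List.getElem_append, this]
  intro k k' h
  rw [hinv, hinv] at h
  exact Fin.ext ((hl.getElem_inj_iff).1 h)

/-- The response time of an operation of the history at time `N`, or `N` if it is pending. -/
def ConcHistory.retD {Op Res : Type} (h : ConcHistory Op Res) (N : ℕ) (k : Fin h.m) : ℕ :=
  (h.ret k).getD N

theorem Finish.exists_historyAt (hR : Run c sched) {e N : ℕ} {i : Fin n} {op : StackOp}
    {t₀ : ℕ} {res : StackRes} (h : Finish c sched e i op t₀ res) (he : e < N) :
    ∃ k, (historyAt (c N)).op k = op ∧ (historyAt (c N)).inv k = t₀ := by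
  rcases h.pending_or_logged hR he with ⟨h, -⟩ | ⟨a, ha, rfl, rfl, -⟩
  · exact exists_historyAt_of_pend h
  · exact exists_historyAt_of_log ha

theorem Finish.lt_retD (hR : Run c sched) {e N : ℕ} {i : Fin n} {op : StackOp}
    {k : Fin (historyAt (c N)).m} {res : StackRes}
    (h : Finish c sched e i op ((historyAt (c N)).inv k) res) (he : e < N) :
    e < (historyAt (c N)).retD N k := by
  rcases historyAt_cases (c N) k with ⟨a, ha, h1, h2, h3, -⟩ | ⟨i, -, h3, -⟩
  · obtain ⟨-, ⟨e', he', h'⟩, -⟩ := (hR.logInv N).entry a ha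
    rw [h2] at h
    rw [(h.unique hR h').1, ConcHistory.retD, h3]
    exact he'
  · simpa [ConcHistory.retD, h3] using he

theorem Run.exists_finish_of_out (hR : Run c sched) {N : ℕ} {k : Fin (historyAt (c N)).m}
    {res : StackRes} (h : (historyAt (c N)).out k = some res) :
    ∃ e < N, ∃ i, Finish c sched e i ((historyAt (c N)).op k) ((historyAt (c N)).inv k) res := by
  rcases historyAt_cases (c N) k with ⟨a, ha, h1, h2, -, h3⟩ | ⟨i, -, -, h3⟩
  · obtain ⟨h0, ⟨e, he, h'⟩, -⟩ := (hR.logInv N).entry a ha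
    rw [h3] at h
    obtain rfl : a.res = res := by simpa using h
    exact ⟨e, by omega, a.proc, h1 ▸ h2 ▸ h'⟩
  · rw [h3] at h
    cases h

end History

section Assembly

variable {n : ℕ} {c : ℕ → Config n} {sched : ℕ → Fin n}

/-- Operation `k` of the history at time `N` computes its result in step `e < N`. -/
def FinishesAt (c : ℕ → Config n) (sched : ℕ → Fin n) (N : ℕ) (k : Fin (historyAt (c N)).m)
    (e : ℕ) (res : StackRes) : Prop :=
  e < N ∧ Finish c sched e (sched e) ((historyAt (c N)).op k) ((historyAt (c N)).inv k) res

/-- Operation `k` of the history at time `N` takes part in an abstract operation. -/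
def Represents (c : ℕ → Config n) (sched : ℕ → Fin n) (N : ℕ) (k : Fin (historyAt (c N)).m) :
    AbsOp (ℕ ×ₗ ℕ) (Fin (historyAt (c N)).m) → Prop
  | .push y => ∃ e x, FinishesAt c sched N k e StackRes.ok ∧ Writes c sched y e x
  | .pop y => ∃ e x, FinishesAt c sched N k e (StackRes.val x) ∧ Erases c sched y e x
  | .eps k' => k' = k ∧ ∃ e, FinishesAt c sched N k e StackRes.empty

theorem FinishesAt.unique (hR : Run c sched) {N : ℕ} {k : Fin (historyAt (c N)).m}
    {e e' : ℕ} {res res' : StackRes} (h : FinishesAt c sched N k e res)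
    (h' : FinishesAt c sched N k e' res') : e = e' ∧ res = res' :=
  ⟨(h.2.unique hR h'.2).1, (h.2.unique hR h'.2).2.2⟩

theorem FinishesAt.index_unique (hR : Run c sched) {N : ℕ} {k k' : Fin (historyAt (c N)).m}
    {e : ℕ} {res res' : StackRes} (h : FinishesAt c sched N k e res)
    (h' : FinishesAt c sched N k' e res') : k = k' := by
  have := h.2.pend
  rw [h'.2.pend] at this
  simp only [Option.some.injEq, Prod.mk.injEq] at this
  exact hR.historyAt_inv_injective N this.2.symm

theorem Represents.unique (hR : Run c sched) {N : ℕ} {k : Fin (historyAt (c N)).m}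
    {o o' : AbsOp (ℕ ×ₗ ℕ) (Fin (historyAt (c N)).m)} (h : Represents c sched N k o)
    (h' : Represents c sched N k o') : o = o' := by
  rcases o with y | y | j <;> rcases o' with y' | y' | j' <;> simp only [Represents] at h h'
  case push.push =>
    obtain ⟨e, x, h1, t, h2, rfl⟩ := h
    obtain ⟨e', x', h1', t', h2', rfl⟩ := h'
    obtain ⟨rfl, -⟩ := h1.unique hR h1'
    rw [h2] at h2'
    simp only [PS.push3.injEq] at h2'
    rw [h2'.2]
  case pop.pop =>
    obtain ⟨e, x, h1, h2⟩ := h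
    obtain ⟨e', x', h1', h2'⟩ := h'
    obtain ⟨rfl, -⟩ := h1.unique hR h1'
    rw [Erases, h2] at h2'
    simp only [PS.popFound.injEq] at h2'
    have : y = y' := ofLex.injective (Prod.ext h2'.1 h2'.2.1)
    rw [this]
  case eps.eps => rw [h.1, h'.1]
  case push.pop | pop.push =>
    obtain ⟨e, x, h1, -⟩ := h
    obtain ⟨e', x', h1', -⟩ := h'
    cases (h1.unique hR h1').2
  case push.eps | pop.eps =>
    obtain ⟨e, x, h1, -⟩ := h
    obtain ⟨-, e', h1'⟩ := h'
    cases (h1.unique hR h1').2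
  case eps.push | eps.pop =>
    obtain ⟨-, e, h1⟩ := h
    obtain ⟨e', x', h1', -⟩ := h'
    cases (h1.unique hR h1').2

theorem FinishesAt.exists_represents (hR : Run c sched) {N : ℕ} {k : Fin (historyAt (c N)).m}
    {e : ℕ} {res : StackRes} (h : FinishesAt c sched N k e res) :
    ∃ o, Represents c sched N k o := by
  rcases h.2.cases hR with ⟨y, x, h1, rfl⟩ | ⟨y, x, h1, rfl⟩ | ⟨rfl, -⟩
  · exact ⟨.push y, e, x, h, h1⟩
  · exact ⟨.pop y, e, x, h, h1⟩
  · exact ⟨.eps k, rfl, e, h⟩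

theorem Writes.exists_represents (hR : Run c sched) {N e x : ℕ} {y : ℕ ×ₗ ℕ}
    (h : Writes c sched y e x) (he : e < N) : ∃ k, Represents c sched N k (.push y) := by
  obtain ⟨t₀, h1, -⟩ := h.finish hR
  obtain ⟨k, h2, h3⟩ := h1.exists_historyAt hR he
  exact ⟨k, e, x, ⟨he, by rw [h2, h3]; exact h1⟩, h⟩

theorem Erases.exists_represents (hR : Run c sched) {N e x : ℕ} {y : ℕ ×ₗ ℕ}
    (h : Erases c sched y e x) (he : e < N) : ∃ k, Represents c sched N k (.pop y) := by
  obtain ⟨t₀, ρ, rt, h1, -⟩ := h.finish hR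
  obtain ⟨k, h2, h3⟩ := h1.exists_historyAt hR he
  exact ⟨k, e, x, ⟨he, by rw [h2, h3]; exact h1⟩, h⟩

/-- Two pops by the same process erasing the same position are the same operation. -/
theorem Represents.eq_of_sched_eq (hR : Run c sched) {N : ℕ} {k k' : Fin (historyAt (c N)).m}
    {y : ℕ ×ₗ ℕ} {e e' x x' : ℕ} (h : FinishesAt c sched N k e (StackRes.val x))
    (hE : Erases c sched y e x) (h' : FinishesAt c sched N k' e' (StackRes.val x'))
    (hE' : Erases c sched y e' x') (hs : sched e = sched e') : k = k' := by
  wlog hle : e ≤ e' generalizing k k' e e' x x'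
  · exact (this h' hE' h hE hs.symm (by omega)).symm
  obtain ⟨t₀, ρ, rt, h1, h2, h3, -, h4⟩ := hE'.finish hR
  obtain ⟨-, -, -, hrt⟩ := hR.read_between h4
  have hrt := hrt e x hE
  have h5 := (hR.pend_persists h1.pend).2.2 e (by omega) hle
  have h6 := h1.pend
  rw [h'.2.pend] at h6
  rw [← hs, h.2.pend] at h5
  simp only [Option.some.injEq, Prod.mk.injEq] at h5 h6
  exact hR.historyAt_inv_injective N (h5.2.trans h6.2.symm)

/-- The step at which position `y` is written. -/
noncomputable def writeTime (c : ℕ → Config n) (sched : ℕ → Fin n) (y : ℕ ×ₗ ℕ) : ℕ :=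
  sInf {e | ∃ x, Writes c sched y e x}

/-- The step at which position `y` is first erased. -/
noncomputable def eraseTime (c : ℕ → Config n) (sched : ℕ → Fin n) (y : ℕ ×ₗ ℕ) : ℕ :=
  sInf {e | ∃ x, Erases c sched y e x}

theorem Writes.writeTime_eq (hR : Run c sched) {e x : ℕ} {y : ℕ ×ₗ ℕ}
    (h : Writes c sched y e x) : writeTime c sched y = e := by
  obtain ⟨x', h'⟩ := Nat.sInf_mem (s := {e | ∃ x, Writes c sched y e x}) ⟨e, x, h⟩
  exact (h'.unique hR h).1

theorem Scanned.scanOK (hR : Run c sched) {N lo k hi : ℕ} {q : ℕ ×ₗ ℕ} {ρ : ℕ ×ₗ ℕ → ℕ}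
    {S : Set (ℕ ×ₗ ℕ)} (h : Scanned c lo k q ρ) (hk : k ≤ hi) (hN : k ≤ N)
    (hS : ∀ y ∈ S, q < y ∧ ∃ e x, Writes c sched y e x) :
    ScanOK (fun y => ∃ j, Represents c sched N j (.pop y)) (writeTime c sched)
      (eraseTime c sched) lo hi ρ S where
  lo_le y hy := h.lo_le y (hS y hy).1
  le_hi y hy := (h.le_hi y (hS y hy).1).trans hk
  absent y hy := by
    obtain ⟨hq, e, x, hw⟩ := hS y hy
    rw [hw.writeTime_eq hR, or_iff_not_imp_left, not_le]
    intro he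
    have h1 := h.absent y hq
    have h2 := h.le_hi y hq
    rcases hw.cell_cases hR he with ⟨h3, -⟩ | ⟨-, w, x', h3, h4, h5⟩
    · rw [h1] at h3
      cases h3
    · have h6 : eraseTime c sched y ≤ w := Nat.sInf_le ⟨x', h5⟩
      exact ⟨h5.exists_represents hR (by omega), h6.trans h4.le⟩
  anti y hy z hz := h.anti y z (hS y hy).1

open Classical in
/-- The operations taking part in an abstract operation. -/
noncomputable def members (c : ℕ → Config n) (sched : ℕ → Fin n) (N : ℕ)
    (o : AbsOp (ℕ ×ₗ ℕ) (Fin (historyAt (c N)).m)) : Finset (Fin (historyAt (c N)).m) :=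
  Finset.univ.filter fun k => Represents c sched N k o

theorem mem_members {N : ℕ} {o : AbsOp (ℕ ×ₗ ℕ) (Fin (historyAt (c N)).m)}
    {k : Fin (historyAt (c N)).m} : k ∈ members c sched N o ↔ Represents c sched N k o := by
  simp [members]

/-- The latest invocation of a member of an abstract operation. -/
noncomputable def absInv (c : ℕ → Config n) (sched : ℕ → Fin n) (N : ℕ)
    (o : AbsOp (ℕ ×ₗ ℕ) (Fin (historyAt (c N)).m)) : ℕ :=
  (members c sched N o).sup (historyAt (c N)).inv

/-- The earliest response of a member of an abstract operation. -/
noncomputable def absRet (c : ℕ → Config n) (sched : ℕ → Fin n) (N : ℕ)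
    (o : AbsOp (ℕ ×ₗ ℕ) (Fin (historyAt (c N)).m)) : ℕ :=
  sInf {t | ∃ k, Represents c sched N k o ∧ (historyAt (c N)).retD N k = t}

theorem Represents.inv_le {N : ℕ} {o : AbsOp (ℕ ×ₗ ℕ) (Fin (historyAt (c N)).m)}
    {k : Fin (historyAt (c N)).m} (h : Represents c sched N k o) :
    (historyAt (c N)).inv k ≤ absInv c sched N o :=
  Finset.le_sup (mem_members.2 h)

theorem Represents.ret_le {N : ℕ} {o : AbsOp (ℕ ×ₗ ℕ) (Fin (historyAt (c N)).m)}
    {k : Fin (historyAt (c N)).m} (h : Represents c sched N k o) :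
    absRet c sched N o ≤ (historyAt (c N)).retD N k :=
  Nat.sInf_le ⟨k, h, rfl⟩

theorem Represents.exists_inv {N : ℕ} {o : AbsOp (ℕ ×ₗ ℕ) (Fin (historyAt (c N)).m)}
    {k : Fin (historyAt (c N)).m} (h : Represents c sched N k o) :
    ∃ j, Represents c sched N j o ∧ absInv c sched N o = (historyAt (c N)).inv j := by
  obtain ⟨j, hj, h1⟩ := Finset.exists_mem_eq_sup (members c sched N o) ⟨k, mem_members.2 h⟩ (historyAt (c N)).inv
  exact ⟨j, mem_members.1 hj, h1⟩

theorem Represents.exists_ret {N : ℕ} {o : AbsOp (ℕ ×ₗ ℕ) (Fin (historyAt (c N)).m)}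
    {k : Fin (historyAt (c N)).m} (h : Represents c sched N k o) :
    ∃ j, Represents c sched N j o ∧ (historyAt (c N)).retD N j = absRet c sched N o :=
  Nat.sInf_mem (s := {t | ∃ k, Represents c sched N k o ∧ (historyAt (c N)).retD N k = t})
    ⟨_, k, h, rfl⟩

theorem Represents.push_bounds (hR : Run c sched) {N : ℕ} {k : Fin (historyAt (c N)).m}
    {y : ℕ ×ₗ ℕ} (h : Represents c sched N k (.push y)) :
    absInv c sched N (.push y) ≤ writeTime c sched y ∧
      writeTime c sched y < absRet c sched N (.push y) := by
  constructor
  · obtain ⟨j, ⟨e, x, h1, h2⟩, hj⟩ := h.exists_inv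
    rw [hj, h2.writeTime_eq hR]
    exact (hR.pend_persists h1.2.pend).1.le
  · obtain ⟨j, ⟨e, x, h1, h2⟩, hj⟩ := h.exists_ret
    rw [← hj, h2.writeTime_eq hR]
    exact h1.2.lt_retD hR h1.1

theorem Represents.pop_bounds (hR : Run c sched) {N : ℕ} {k : Fin (historyAt (c N)).m}
    {y : ℕ ×ₗ ℕ} (h : Represents c sched N k (.pop y)) :
    (∃ ρ, ScanOK (fun y => ∃ j, Represents c sched N j (.pop y)) (writeTime c sched)
      (eraseTime c sched) (absInv c sched N (.pop y)) (eraseTime c sched y) ρ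
      {z | (∃ e x, Writes c sched z e x) ∧ y < z}) ∧
    writeTime c sched y ≤ eraseTime c sched y ∧
    absInv c sched N (.pop y) ≤ eraseTime c sched y ∧
    eraseTime c sched y ≤ absRet c sched N (.pop y) := by
  have hret : eraseTime c sched y ≤ absRet c sched N (.pop y) := by
    obtain ⟨j, ⟨e, x, h1, h2⟩, hj⟩ := h.exists_ret
    rw [← hj]
    have h3 : eraseTime c sched y ≤ e := Nat.sInf_le ⟨x, h2⟩
    exact h3.trans (h1.2.lt_retD hR h1.1).le
  obtain ⟨j, ⟨e, x, h1, h2⟩, hj⟩ := h.exists_inv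
  obtain ⟨t₀, ρ, rt, h3, h4, h5, h6, h7⟩ := h2.finish hR
  obtain rfl : (historyAt (c N)).inv j = t₀ := by
    have := h1.2.pend
    rw [h3.pend] at this
    simp only [Option.some.injEq, Prod.mk.injEq] at this
    exact this.2.symm
  obtain ⟨e', h8, h9, h10⟩ := hR.read_between h7
  obtain ⟨x', hx'⟩ := Nat.sInf_mem (s := {e | ∃ x, Erases c sched y e x}) ⟨e, x, h2⟩
  have hrt : rt ≤ eraseTime c sched y := h10 _ _ hx'
  have heN := h1.1
  refine ⟨⟨ρ, ?_⟩, ?_, ?_, hret⟩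
  · rw [hj]
    exact h6.scanOK hR hrt (by omega) fun z hz => ⟨hz.2, hz.1⟩
  · rw [h9.writeTime_eq hR]
    omega
  · omega

theorem Represents.eps_bounds (hR : Run c sched) {N : ℕ} {k : Fin (historyAt (c N)).m}
    (h : Represents c sched N k (.eps k)) :
    (∃ ρ, ScanOK (fun y => ∃ j, Represents c sched N j (.pop y)) (writeTime c sched)
      (eraseTime c sched) (absInv c sched N (.eps k)) (absRet c sched N (.eps k)) ρ
      {z | ∃ e x, Writes c sched z e x}) ∧
    absInv c sched N (.eps k) ≤ absRet c sched N (.eps k) := by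
  obtain ⟨j, ⟨rfl, e, h1⟩, hj⟩ := h.exists_inv
  obtain ⟨j', ⟨rfl, e', h1'⟩, hj'⟩ := h.exists_ret
  have h2 := h1.2.lt_retD hR h1.1
  have heN := h1.1
  rcases h1.2.cases hR with ⟨_, _, -, h3⟩ | ⟨_, _, -, h3⟩ | ⟨-, -, h3, ρ, h4⟩
  · cases h3
  · cases h3
  rw [hj, ← hj']
  refine ⟨⟨ρ, h4.scanOK hR h2.le (by omega) fun z hz => ⟨?_, hz⟩⟩, by omega⟩
  obtain ⟨e, x, t, -, rfl⟩ := hz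
  rw [Prod.Lex.lt_iff]
  simp only [ofLex_toLex]
  omega

theorem Represents.push_lt (hR : Run c sched) {N : ℕ} {k k' : Fin (historyAt (c N)).m}
    {y z : ℕ ×ₗ ℕ} (h : Represents c sched N k (.push y)) (h' : Represents c sched N k' (.push z))
    (hlt : absRet c sched N (.push y) < absInv c sched N (.push z)) : y < z := by
  have hy := (h.push_bounds hR).2
  obtain ⟨e, x, -, hw⟩ := h
  rw [hw.writeTime_eq hR] at hy
  obtain ⟨j, ⟨e', x', h1, h2⟩, hj⟩ := h'.exists_inv
  obtain ⟨t₀, h3, -, ⟨a, h4, h5⟩, -⟩ := h2.finish hR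
  obtain ⟨-, -, -, -, h6⟩ := hw.finish hR
  obtain rfl : (historyAt (c N)).inv j = t₀ := by
    have := h1.2.pend
    rw [h3.pend] at this
    simp only [Option.some.injEq, Prod.mk.injEq] at this
    exact this.2.symm
  have h7 : (c e).top ≤ (c a).top := hR.top_mono (by omega : e ≤ a)
  rw [Prod.Lex.lt_iff]
  omega

/-- A legal sequence of the abstract operations of the history at time `N`. -/
theorem Run.exists_sequence (hR : Run c sched) (N : ℕ) :
    ∃ L : List (AbsOp (ℕ ×ₗ ℕ) (Fin (historyAt (c N)).m)), L.Nodup ∧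
      (∀ o, o ∈ L ↔ ∃ k, Represents c sched N k o) ∧
      L.Pairwise (fun a b => ¬ absRet c sched N b < absInv c sched N a) ∧
      AbsOp.Valid [] L := by
  classical
  have hfin : {y | ∃ k, Represents c sched N k (.push y)}.Finite := by
    choose f hf using fun y : {y | ∃ k, Represents c sched N k (.push y)} => y.2
    have : Finite {y | ∃ k, Represents c sched N k (.push y)} := by
      refine Finite.of_injective f fun y z hyz => Subtype.ext ?_
      have h1 := hf y
      rw [hyz] at h1
      simpa using h1.unique hR (hf z)
    exact Set.toFinite _
  let es : List (Fin (historyAt (c N)).m) :=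
    (Finset.univ.filter fun k => Represents c sched N k (.eps k)).toList
  have hes : ∀ k, k ∈ es ↔ Represents c sched N k (.eps k) := by
    intro k
    simp [es]
  have hs : ∀ y, y ∈ hfin.toFinset ↔ ∃ k, Represents c sched N k (.push y) := by
    intro y
    simp
  have hρ : ∀ o : AbsOp (ℕ ×ₗ ℕ) (Fin (historyAt (c N)).m), ∃ ρ : ℕ ×ₗ ℕ → ℕ, match o with
      | .push _ => True
      | .pop y => (∃ k, Represents c sched N k (.pop y)) →
          ScanOK (fun y => ∃ j, Represents c sched N j (.pop y)) (writeTime c sched)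
            (eraseTime c sched) (absInv c sched N (.pop y)) (eraseTime c sched y) ρ
            {z | (∃ e x, Writes c sched z e x) ∧ y < z}
      | .eps k => Represents c sched N k (.eps k) →
          ScanOK (fun y => ∃ j, Represents c sched N j (.pop y)) (writeTime c sched)
            (eraseTime c sched) (absInv c sched N (.eps k)) (absRet c sched N (.eps k)) ρ
            {z | ∃ e x, Writes c sched z e x} := by
    rintro (y | y | k)
    · exact ⟨fun _ => 0, trivial⟩
    · by_cases h : ∃ k, Represents c sched N k (.pop y)
      · obtain ⟨k, hk⟩ := h
        obtain ⟨ρ, hρ⟩ := (hk.pop_bounds hR).1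
        exact ⟨ρ, fun _ => hρ⟩
      · exact ⟨fun _ => 0, fun h' => absurd h' h⟩
    · by_cases h : Represents c sched N k (.eps k)
      · obtain ⟨ρ, hρ⟩ := (h.eps_bounds hR).1
        exact ⟨ρ, fun _ => hρ⟩
      · exact ⟨fun _ => 0, fun h' => absurd h' h⟩
  choose ρ hρ using hρ
  have hsub : ∀ y, y ∈ hfin.toFinset → ∃ e x, Writes c sched y e x := by
    intro y hy
    obtain ⟨k, e, x, -, h⟩ := (hs y).1 hy
    exact ⟨e, x, h⟩
  obtain ⟨L, h1, h2, h3, h4⟩ := exists_valid_sequence es (Finset.nodup_toList _)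
    (absRet c sched N) (fun y => ∃ j, Represents c sched N j (.pop y)) (writeTime c sched)
    (eraseTime c sched) ρ hfin.toFinset (absInv c sched N)
    (fun y hy => by
      obtain ⟨k, hk⟩ := (hs y).1 hy
      exact ⟨(hk.push_bounds hR).1, (hk.push_bounds hR).2.le⟩)
    (fun y _ ⟨k, hk⟩ => (hk.pop_bounds hR).2)
    (fun k hk => (((hes k).1 hk).eps_bounds hR).2)
    (fun y hy z hz hlt => by
      obtain ⟨k, hk⟩ := (hs y).1 hy
      obtain ⟨k', hk'⟩ := (hs z).1 hz
      exact hk.push_lt hR hk' hlt)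
    (fun y _ hp => by
      have h := hρ (.pop y) hp
      exact ⟨fun z hz => h.lo_le z ⟨hsub z hz.1, hz.2⟩, fun z hz => h.le_hi z ⟨hsub z hz.1, hz.2⟩,
        fun z hz => h.absent z ⟨hsub z hz.1, hz.2⟩,
        fun z hz z' hz' => h.anti z ⟨hsub z hz.1, hz.2⟩ z' ⟨hsub z' hz'.1, hz'.2⟩⟩)
    (fun k hk => by
      have h := hρ (.eps k) ((hes k).1 hk)
      exact ⟨fun z hz => h.lo_le z (hsub z hz), fun z hz => h.le_hi z (hsub z hz),
        fun z hz => h.absent z (hsub z hz),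
        fun z hz z' hz' => h.anti z (hsub z hz) z' (hsub z' hz')⟩)
  refine ⟨L, h1, fun o => ?_, h3, h4⟩
  rw [h2]
  rcases o with y | y | k
  · exact hs y
  · refine ⟨fun h => h.2, fun h => ⟨?_, h⟩⟩
    obtain ⟨k, e, x, h5, h6⟩ := h
    obtain ⟨t₀, _, rt, -, h7, -, -, h8⟩ := h6.finish hR
    obtain ⟨e', h9, h10, -⟩ := hR.read_between h8
    have := h5.1
    exact (hs y).2 (h10.exists_represents hR (by omega))
  · refine (hes k).trans ⟨fun h => ⟨k, h⟩, ?_⟩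
    rintro ⟨j, hj⟩
    obtain rfl : k = j := hj.1
    exact hj

theorem Run.setLinearizable (hR : Run c sched) (N : ℕ) :
    SetLinearizable n (historyAt (c N)) := by
  classical
  obtain ⟨L, hnd, hmem, hord, hval⟩ := hR.exists_sequence N
  let val : ℕ ×ₗ ℕ → ℕ := fun y =>
    if h : ∃ x e, Writes c sched y e x then h.choose else 0
  have hvalue : ∀ {y e x}, Writes c sched y e x → val y = x := by
    intro y e x h
    have hex : ∃ x e, Writes c sched y e x := ⟨x, e, h⟩
    obtain ⟨e', h'⟩ := hex.choose_spec
    simp only [val, dif_pos hex]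
    exact (h'.unique hR h).2
  let lout : Fin (historyAt (c N)).m → StackRes := fun k =>
    if h : ∃ res e, FinishesAt c sched N k e res then h.choose else StackRes.ok
  have hlout : ∀ {k e res}, FinishesAt c sched N k e res → lout k = res := by
    intro k e res h
    have hex : ∃ res e, FinishesAt c sched N k e res := ⟨res, e, h⟩
    obtain ⟨e', h'⟩ := hex.choose_spec
    simp only [lout, dif_pos hex]
    exact (h'.unique hR h).2
  let cls : Fin (historyAt (c N)).m → Option (Fin L.length) := fun k =>
    if h : ∃ j : Fin L.length, Represents c sched N k (L.get j) then some h.choose else none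
  have hcls : ∀ k j, cls k = some j ↔ Represents c sched N k (L.get j) := by
    intro k j
    constructor
    · intro h
      by_cases hex : ∃ j : Fin L.length, Represents c sched N k (L.get j)
      · simp only [cls, dif_pos hex, Option.some.injEq] at h
        exact h ▸ hex.choose_spec
      · simp only [cls, dif_neg hex, reduceCtorEq] at h
    · intro h
      have hex : ∃ j : Fin L.length, Represents c sched N k (L.get j) := ⟨j, h⟩
      simp only [cls, dif_pos hex, Option.some.injEq]
      exact List.nodup_iff_injective_get.1 hnd (hex.choose_spec.unique hR h)
  have hout : ∀ {k res}, (historyAt (c N)).out k = some res →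
      ∃ e, FinishesAt c sched N k e res := by
    intro k res h
    obtain ⟨e, he, i, h1⟩ := hR.exists_finish_of_out h
    obtain rfl := h1.sched_eq
    exact ⟨e, he, h1⟩
  have hle : ∀ {k o}, Represents c sched N k o →
      absInv c sched N o ≤ absRet c sched N o := by
    intro k o h
    rcases o with y | y | j
    · have := h.push_bounds hR
      omega
    · have := (h.pop_bounds hR).2
      omega
    · obtain rfl : j = k := h.1
      exact (h.eps_bounds hR).2
  refine ⟨⟨L.length, cls, lout, fun j => ((L.take j).foldl AbsOp.next []).map val,
    ?_, ?_, ?_, ?_, ?_, ?_⟩⟩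
  · intro k hk
    obtain ⟨res, hres⟩ := Option.isSome_iff_exists.1 hk
    obtain ⟨e, he⟩ := hout hres
    obtain ⟨o, ho⟩ := he.exists_represents hR
    obtain ⟨j, hj⟩ := List.get_of_mem ((hmem o).2 ⟨k, ho⟩)
    exact Option.isSome_iff_exists.2 ⟨j, (hcls k j).2 (hj ▸ ho)⟩
  · intro k res hres
    obtain ⟨e, he⟩ := hout hres
    exact hlout he
  · simp
  · intro j
    obtain ⟨k, hk⟩ := (hmem (L.get j)).1 (List.get_mem _ _)
    exact ⟨k, (hcls k j).2 hk⟩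
  · intro j
    have hen := hval.enabled_foldl j j.isLt
    obtain ⟨k, hk⟩ := (hmem (L.get j)).1 (List.get_mem _ _)
    have hstate : (L.take (j.succ : Fin (L.length + 1))).foldl AbsOp.next [] =
        AbsOp.next ((L.take j).foldl AbsOp.next []) (L.get j) := by
      rw [Fin.val_succ, List.take_add_one, List.foldl_append]
      simp
    simp only [hstate, hcls, Fin.val_castSucc]
    simp only [List.get_eq_getElem] at *
    generalize (L.take j).foldl AbsOp.next [] = q at *
    generalize L[(j : ℕ)] = o at *
    rcases o with y | y | k'
    · obtain ⟨e, x, h1, h2⟩ := hk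
      refine Or.inl ⟨k, x, ?_, ?_, hlout h1, ?_⟩
      · ext k'
        simp only [Finset.mem_filter, Finset.mem_univ, true_and, Finset.mem_singleton]
        constructor
        · rintro ⟨e', x', h1', h2'⟩
          obtain rfl := (h2.unique hR h2').1
          exact h1'.index_unique hR h1
        · rintro rfl
          exact ⟨e, x, h1, h2⟩
      · obtain ⟨t₀, h3, -⟩ := h2.finish hR
        have := h1.2.pend
        rw [h3.pend] at this
        simp only [Option.some.injEq, Prod.mk.injEq] at this
        exact this.1.symm
      · simp [AbsOp.next, hvalue h2]
    · obtain ⟨q', rfl⟩ : ∃ q', q = y :: q' := by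
        cases q with
        | nil => simp [AbsOp.Enabled] at hen
        | cons a q => exact ⟨q, by simpa [AbsOp.Enabled] using hen⟩
      refine Or.inr (Or.inl ⟨val y, by simp [AbsOp.next], ?_, ?_, ?_⟩)
      · exact Finset.card_pos.2 ⟨k, by simpa using hk⟩
      · have hex : ∀ k', Represents c sched N k' (.pop y) →
            ∃ e x, FinishesAt c sched N k' e (StackRes.val x) ∧ Erases c sched y e x :=
          fun k' h => h
        choose! f x hf using hex
        calc _ ≤ (Finset.univ : Finset (Fin n)).card := by
              refine Finset.card_le_card_of_injOn (fun k' => sched (f k')) (by simp) ?_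
              intro a ha b hb hab
              simp only [Finset.coe_filter, Finset.mem_univ, true_and, Set.mem_ofPred_eq] at ha hb
              exact Represents.eq_of_sched_eq hR (hf a ha).1 (hf a ha).2 (hf b hb).1
                (hf b hb).2 hab
          _ = n := by simp
      · intro k' hk'
        obtain ⟨e, x, h1, h2⟩ : Represents c sched N k' (.pop y) := by simpa using hk'
        obtain ⟨t₀, _, rt, h3, -, -, -, h4⟩ := h2.finish hR
        obtain ⟨e', -, h5, -⟩ := hR.read_between h4
        refine ⟨?_, by rw [hlout h1, hvalue h5]⟩
        have := h1.2.pend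
        rw [h3.pend] at this
        simp only [Option.some.injEq, Prod.mk.injEq] at this
        exact this.1.symm
    · obtain ⟨rfl, e, h1⟩ := hk
      obtain rfl : q = [] := hen
      refine Or.inr (Or.inr ⟨k', ?_, ?_, hlout h1, rfl, rfl⟩)
      · ext j'
        simp only [Finset.mem_filter, Finset.mem_univ, true_and, Finset.mem_singleton]
        constructor
        · intro h
          exact h.1.symm
        · rintro rfl
          exact ⟨rfl, e, h1⟩
      · rcases h1.2.cases hR with ⟨_, _, -, h3⟩ | ⟨_, _, -, h3⟩ | ⟨-, h3, -⟩
        · cases h3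
        · cases h3
        · exact h3
  · rintro k k' j j' ⟨t, ht, hlt⟩ hj hj'
    rw [hcls] at hj hj'
    have h1 := hj.ret_le
    have h2 := hj'.inv_le
    rw [ConcHistory.retD, ht, Option.getD_some] at h1
    by_contra hcon
    rcases (not_lt.1 hcon).eq_or_lt with h | h
    · obtain rfl : j' = j := Fin.ext h
      have := hle hj
      omega
    · exact List.pairwise_iff_get.1 hord j' j h (by omega)

end Assembly

/-- The algorithm SetSeqStack — which uses only read/write base objects (an array
of read/write registers and a read/write wait-free linearizable counter, here taken
atomic since it is linearizable) — is a wait-free set-linearizable implementation of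
the set-concurrent stack with multiplicity: (1) a process that keeps being scheduled
completes every operation it invokes, and (2) every execution (assuming every item
is pushed at most once) is set-linearizable. -/
theorem setSeqStack_waitFree_and_setLinearizable (n : ℕ) (hn : 1 ≤ n) :
    (∀ (c : ℕ → Config n) (sched : ℕ → Fin n), Run c sched →
      ∀ i : Fin n, (∀ k, ∃ k' ≥ k, sched k' = i) →
        ∀ k, (c k).pend i ≠ none → ∃ k' > k, (c k').pend i = none) ∧
    (∀ (c : ℕ → Config n) (sched : ℕ → Fin n), Run c sched → ∀ N : ℕ,
      (∀ (i j : Fin (historyAt (c N)).m) (x : ℕ),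
          (historyAt (c N)).op i = StackOp.push x →
          (historyAt (c N)).op j = StackOp.push x → i = j) →
      SetLinearizable n (historyAt (c N))) := by
  exact ⟨fun c sched hR i hi k hk => hR.exists_respond hi k hk,
    fun c sched hR N _ => hR.setLinearizable N⟩
end

section
/- In any execution of the algorithm SetSeqStack, if two Push operations obtain the same value top in their read of the counter Top (and hence store their items in the same row of the array Items), then the two Push operations are concurrent. -/
/-- The operation that process `i` invoked at time `t` completes (responds) at
time `r`: it is still pending at time `r` and no longer pending at time `r + 1`. -/
def CompletesAt {n : ℕ} (c : ℕ → Config n) (i : Fin n) (t r : ℕ) : Prop :=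
  (∃ op, (c r).pend i = some (op, t)) ∧ (c (r + 1)).pend i = none

/-- The operation invoked by process `i` at time `t1` precedes the operation
invoked by process `j` at time `t2`: the former responds before the latter is
invoked. -/
def OpPrecedes {n : ℕ} (c : ℕ → Config n) (i : Fin n) (t1 : ℕ) (j : Fin n) (t2 : ℕ) : Prop :=
  ∃ r, CompletesAt c i t1 r ∧ r < t2

namespace Step

variable {n : ℕ} {c c' : Config n} {s : Fin n}

theorem time_eq_s8 (h : Step c s c') : c'.time = c.time + 1 := by
  cases h <;> rfl

theorem top_le_s8 (h : Step c s c') : c.top ≤ c'.top := by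
  cases h <;> simp

/-- A step leaves a pending operation alone, completes it, or invokes a new one. -/
theorem pend_cases_s8 (h : Step c s c') (i : Fin n) :
    c'.pend i = c.pend i ∨
      (c'.pend i = none ∧ ∃ res, c.proc i = PS.done res) ∨
      (c.pend i = none ∧ ∃ op, c'.pend i = some (op, c.time)) := by
  by_cases hi : i = s
  · subst hi
    cases h <;> simp_all
  · cases h <;> simp [Function.update_of_ne hi]

/-- A process about to increment `Top` either stays there or has made `Top` grow. -/
theorem push2_next (h : Step c s c') {i : Fin n} {x b : ℕ} (hi : c.proc i = PS.push2 x b) :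
    c'.proc i = PS.push2 x b ∨ c'.top = c.top + 1 := by
  by_cases his : i = s
  · subst his
    cases h <;> simp_all
  · cases h <;> simp [Function.update_of_ne his, hi]

/-- A process about to increment `Top` was already there or has just read `Top`. -/
theorem push2_prev (h : Step c s c') {i : Fin n} {x b : ℕ} (hi : c'.proc i = PS.push2 x b) :
    (c.proc i = PS.push2 x b ∨ b = c.top) ∧ c'.pend i = c.pend i := by
  by_cases his : i = s
  · subst his
    cases h <;> simp_all
  · cases h <;> simp_all

end Step

namespace Run

variable {n : ℕ} {c : ℕ → Config n} {sched : ℕ → Fin n}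

theorem time_eq_s8 (h : Run c sched) (k : ℕ) : (c k).time = k := by
  induction k with
  | zero => simp [h.1, initConfig]
  | succ k ih => rw [(h.2 k).time_eq_s8, ih]

theorem top_mono_s8 (h : Run c sched) : Monotone fun k => (c k).top :=
  monotone_nat_of_le_succ fun k => (h.2 k).top_le_s8

theorem invocation_lt (h : Run c sched) {k : ℕ} {i : Fin n} {op : StackOp} {t : ℕ}
    (hp : (c k).pend i = some (op, t)) : t < k := by
  induction k generalizing op with
  | zero => simp [h.1, initConfig] at hp
  | succ k ih =>
    rcases (h.2 k).pend_cases_s8 i with e | ⟨e, -⟩ | ⟨-, op', e⟩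
    · have := ih (e ▸ hp)
      omega
    · simp [e] at hp
    · have := h.time_eq_s8 k
      simp only [e, Option.some.injEq, Prod.mk.injEq] at hp
      omega

/-- The value read by a push is at least that of `Top` just after its invocation. -/
theorem top_le_of_push2 (h : Run c sched) {k : ℕ} {i : Fin n} {op : StackOp} {t x b : ℕ}
    (hp : (c k).pend i = some (op, t)) (hi : (c k).proc i = PS.push2 x b) :
    (c t).top ≤ b ∧ b ≤ (c k).top := by
  induction k with
  | zero => simp [h.1, initConfig] at hp
  | succ k ih =>
    obtain ⟨hb, e⟩ := (h.2 k).push2_prev hi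
    rw [e] at hp
    have hle := (h.2 k).top_le_s8
    rcases hb with hb | rfl
    · have := ih hp hb
      omega
    · exact ⟨h.top_mono_s8 (h.invocation_lt hp).le, hle⟩

/-- An operation that is no longer pending after its invocation is never pending again. -/
theorem not_pending_of_le (h : Run c sched) {k m t : ℕ} {i : Fin n} (ht : t < k) (hkm : k ≤ m)
    (hk : ∀ op, (c k).pend i ≠ some (op, t)) (op : StackOp) : (c m).pend i ≠ some (op, t) := by
  induction m, hkm using Nat.le_induction generalizing op with
  | base => exact hk op
  | succ m hm ih =>
    intro hp
    rcases (h.2 m).pend_cases_s8 i with e | ⟨e, -⟩ | ⟨-, op', e⟩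
    · exact ih op (e ▸ hp)
    · simp [e] at hp
    · have := h.time_eq_s8 m
      simp only [e, Option.some.injEq, Prod.mk.injEq] at hp
      omega

theorem push2_or_lt_top (h : Run c sched) {k m x b : ℕ} {i : Fin n} (hkm : k ≤ m)
    (hi : (c k).proc i = PS.push2 x b) (hb : b ≤ (c k).top) :
    (c m).proc i = PS.push2 x b ∨ b < (c m).top := by
  induction m, hkm using Nat.le_induction with
  | base => exact .inl hi
  | succ m hm ih =>
    have hle := (h.2 m).top_le_s8
    have hmono : (c k).top ≤ (c m).top := h.top_mono_s8 hm
    rcases ih with ih | ih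
    · rcases (h.2 m).push2_next ih with e | e
      · exact .inl e
      · exact .inr (by omega)
    · exact .inr (by omega)

/-- A push that reads `b` from `Top` precedes no push that reads `b` from `Top`. -/
theorem not_opPrecedes_of_push2 (h : Run c sched) {i j : Fin n} {op₁ op₂ : StackOp}
    {x₁ x₂ b t₁ t₂ k₁ k₂ : ℕ}
    (h₁ : (c k₁).proc i = PS.push2 x₁ b) (hp₁ : (c k₁).pend i = some (op₁, t₁))
    (h₂ : (c k₂).proc j = PS.push2 x₂ b) (hp₂ : (c k₂).pend j = some (op₂, t₂)) :
    ¬ OpPrecedes c i t₁ j t₂ := by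
  rintro ⟨r, ⟨⟨op, hr⟩, hr'⟩, hrt⟩
  have htr := h.invocation_lt hr
  have hkr : k₁ ≤ r := by
    by_contra! hlt
    exact h.not_pending_of_le (by omega) (Nat.succ_le_of_lt hlt) (by simp [hr']) op₁ hp₁
  have htop : b < (c r).top := by
    refine (h.push2_or_lt_top hkr h₁ (h.top_le_of_push2 hp₁ h₁).2).resolve_left fun hpr => ?_
    rcases (h.2 r).pend_cases_s8 i with e | ⟨-, res, e⟩ | ⟨e, -⟩ <;> simp_all
  have hmono : (c r).top ≤ (c t₂).top := h.top_mono_s8 hrt.le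
  have := (h.top_le_of_push2 hp₂ h₂).1
  omega

end Run

/-- In any execution of the algorithm SetSeqStack, if two Push operations obtain
the same value `b` in their read of the counter `Top` (and hence store their items
in the same row of `Items`), then the two Push operations are concurrent.
Here the Push operation of process `i` invoked at time `t1` has read `b` from `Top`
(it is in local state `push2 _ b`) at time `k1`, and similarly for `j`, `t2`, `k2`;
the two operations are distinct; one concludes that neither precedes the other. -/
theorem setSeqStack_pushes_same_row_concurrent
    (n : ℕ) (c : ℕ → Config n) (sched : ℕ → Fin n) (hrun : Run c sched)
    (i j : Fin n) (x1 x2 b t1 t2 k1 k2 : ℕ)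
    (h1 : (c k1).proc i = PS.push2 x1 b)
    (h1p : (c k1).pend i = some (StackOp.push x1, t1))
    (h2 : (c k2).proc j = PS.push2 x2 b)
    (h2p : (c k2).pend j = some (StackOp.push x2, t2))
    (hne : (i, t1) ≠ (j, t2)) :
    ¬ OpPrecedes c i t1 j t2 ∧ ¬ OpPrecedes c j t2 i t1 := by
  exact ⟨hrun.not_opPrecedes_of_push2 h1 h1p h2 h2p, hrun.not_opPrecedes_of_push2 h2 h2p h1 h1p⟩
end
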